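/- arXiv:1709.03154 — 2 statements merged into one kernel-verified Lean document; each statement's English description precedes it below -/
import Mathlib

section
/- Let Φ denote the class of upper semi-continuous, concave functions φ : ℝ^d → [-∞, ∞) with φ(x) → -∞ as ‖x‖ → ∞, and for a probability measure P on ℝ^d let L(φ, P) := ∫_{ℝ^d} φ dP − ∫_{ℝ^d} e^φ dx. If P satisfies ∫_{ℝ^d} ‖x‖ dP(x) < ∞ and P(H) < 1 for every hyperplane H ⊆ ℝ^d, then sup_{φ ∈ Φ} L(φ, P) is finite and there exists a unique φ* ∈ Φ maximising L(φ, P) over φ ∈ Φ. Moreover, int(csupp(P)) ⊆ dom(φ*) ⊆ csupp(P), where dom(φ*) := {x : φ*(x) > −∞}. -/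
open MeasureTheory Filter Set
open scoped ENNReal Topology

noncomputable section

/-- `ℝ^d` with its Euclidean norm and Lebesgue measure. -/
abbrev Rd (d : ℕ) : Type := EuclideanSpace ℝ (Fin d)

/-- A nonnegative function is log-concave (`log f` is concave, with `log 0 := -∞`),
expressed multiplicatively via `f x ^ (1-t) * f y ^ t ≤ f ((1-t) • x + t • y)`. -/
def IsLogConcaveFn {E : Type*} [AddCommGroup E] [Module ℝ E] (f : E → ℝ) : Prop :=
  (∀ x, 0 ≤ f x) ∧
  ∀ x y : E, ∀ t : ℝ, t ∈ Set.Icc (0:ℝ) 1 →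
    f x ^ (1 - t) * f y ^ t ≤ f ((1 - t) • x + t • y)

/-- A probability density with respect to the (Lebesgue) measure of a `MeasureSpace`. -/
def IsDensity {E : Type*} [MeasureSpace E] (f : E → ℝ) : Prop :=
  (∀ x, 0 ≤ f x) ∧ Measurable f ∧ ∫⁻ x, ENNReal.ofReal (f x) = 1

/-- Membership in the class `F_d`: an upper semi-continuous log-concave probability
density. -/
def IsLCDensity {E : Type*} [MeasureSpace E] [TopologicalSpace E] [AddCommGroup E]
    [Module ℝ E] (f : E → ℝ) : Prop :=
  IsDensity f ∧ UpperSemicontinuous f ∧ IsLogConcaveFn f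

/-- Membership in the class `P_d`: probability measures with finite first moment that are
not concentrated on any affine hyperplane `{x | l x = c}` (`l` a nonzero linear
functional). -/
def MemP {E : Type*} [NormedAddCommGroup E] [NormedSpace ℝ E] [MeasureSpace E]
    (P : Measure E) : Prop :=
  IsProbabilityMeasure P ∧ Integrable (fun x => ‖x‖) P ∧
  ∀ (l : E →ₗ[ℝ] ℝ) (c : ℝ), l ≠ 0 → P {x | l x = c} < 1

/-- The log-concave projection predicate: `fs ∈ F_d` maximises `∫ log f dP` over `F_d`
(candidates whose objective is `-∞`, i.e. that vanish on a set of positive `P`-measure or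
have non-integrable logarithm, are trivially dominated). -/
def IsLCProj {E : Type*} [NormedAddCommGroup E] [NormedSpace ℝ E] [MeasureSpace E]
    (P : Measure E) (fs : E → ℝ) : Prop :=
  IsLCDensity fs ∧ (∀ᵐ x ∂P, 0 < fs x) ∧ Integrable (fun x => Real.log (fs x)) P ∧
  ∀ g : E → ℝ, IsLCDensity g → (∀ᵐ x ∂P, 0 < g x) →
    Integrable (fun x => Real.log (g x)) P →
    ∫ x, Real.log (g x) ∂P ≤ ∫ x, Real.log (fs x) ∂P

/-- `log y` with values in `[-∞, ∞)`, with the convention `log 0 := -∞`. -/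
def elog (y : ℝ) : EReal := if y ≤ 0 then ⊥ else ((Real.log y : ℝ) : EReal)

/-- Positive part of an extended real number, as an `ℝ≥0∞`. -/
def epos (a : EReal) : ℝ≥0∞ := if a = ⊤ then ⊤ else ENNReal.ofReal a.toReal

/-- `e^a` for an extended real `a`, valued in `[0,∞]`. -/
def expE (a : EReal) : ℝ≥0∞ :=
  if a = ⊥ then 0 else if a = ⊤ then ⊤ else ENNReal.ofReal (Real.exp a.toReal)

/-- Integral of an `EReal`-valued function: positive part minus negative part. -/
def erealIntegral {α : Type*} [MeasurableSpace α] (P : Measure α) (φ : α → EReal) : EReal :=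
  ((∫⁻ x, epos (φ x) ∂P : ℝ≥0∞) : EReal) - ((∫⁻ x, epos (-(φ x)) ∂P : ℝ≥0∞) : EReal)

/-- The class `Φ`: upper semi-continuous, concave functions `φ : E → [-∞, ∞)` with
`φ(x) → -∞` as `‖x‖ → ∞`. -/
def MemPhi {E : Type*} [NormedAddCommGroup E] [NormedSpace ℝ E] (φ : E → EReal) : Prop :=
  (∀ x, φ x ≠ ⊤) ∧ UpperSemicontinuous φ ∧
  (∀ x y : E, ∀ t : ℝ, t ∈ Set.Icc (0:ℝ) 1 →
    (((1 - t : ℝ)) : EReal) * φ x + ((t : ℝ) : EReal) * φ y ≤ φ ((1 - t) • x + t • y)) ∧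
  Tendsto φ (Filter.comap (fun x => ‖x‖) Filter.atTop) (nhds ⊥)

/-- The functional `L(φ, P) = ∫ φ dP - ∫ e^φ dx`. -/
def Lfun {E : Type*} [NormedAddCommGroup E] [NormedSpace ℝ E] [MeasureSpace E]
    (φ : E → EReal) (P : Measure E) : EReal :=
  erealIntegral P φ - ((∫⁻ x, expE (φ x) : ℝ≥0∞) : EReal)

/-- `L*(P) = sup_{φ ∈ Φ} L(φ, P)`. -/
def Lstar {E : Type*} [NormedAddCommGroup E] [NormedSpace ℝ E] [MeasureSpace E]
    (P : Measure E) : EReal :=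
  ⨆ (φ : E → EReal) (_ : MemPhi φ), Lfun φ P

/-- Action of a matrix on a Euclidean vector. -/
def mulVE {m d : ℕ} (A : Matrix (Fin m) (Fin d) ℝ) (x : Rd d) : Rd m :=
  (WithLp.equiv 2 (Fin m → ℝ)).symm (A.mulVec ((WithLp.equiv 2 (Fin d → ℝ)) x))

/-- The convex support of a measure: the intersection of all closed convex sets of full
measure. -/
def csupp {E : Type*} [TopologicalSpace E] [AddCommGroup E] [Module ℝ E]
    [MeasurableSpace E] (P : Measure E) : Set E :=
  ⋂₀ {C : Set E | IsClosed C ∧ Convex ℝ C ∧ P C = 1}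

section ConvexGeometry

variable {E : Type*} [NormedAddCommGroup E] [NormedSpace ℝ E] [FiniteDimensional ℝ E]

/-- In finite dimension, the interior of the closure of a convex set is contained in the set. -/
theorem Convex.interior_closure_subset {s : Set E} (hs : Convex ℝ s) :
    interior (closure s) ⊆ s := by
  intro x hx
  have hne : (interior s).Nonempty := by
    rw [hs.interior_nonempty_iff_affineSpan_eq_top, eq_top_iff]
    have h1 : affineSpan ℝ (closure s) = ⊤ :=
      hs.closure.interior_nonempty_iff_affineSpan_eq_top.1 ⟨x, hx⟩
    rw [← h1, affineSpan_le]
    exact closure_minimal (subset_affineSpan ℝ s)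
      (AffineSubspace.closed_of_finiteDimensional _)
  rw [hs.interior_closure_eq_interior_of_nonempty_interior hne] at hx
  exact interior_subset hx

variable [MeasurableSpace E] [BorelSpace E] (μ : Measure E) [μ.IsAddHaarMeasure]

theorem Convex.interior_nonempty_of_measure_ne_zero {s : Set E} (hs : Convex ℝ s)
    (h : μ s ≠ 0) : (interior s).Nonempty := by
  rw [hs.interior_nonempty_iff_affineSpan_eq_top]
  by_contra hne
  exact h (measure_mono_null (subset_affineSpan ℝ s) (Measure.addHaar_affineSubspace μ _ hne))

/-- A convex set with nonempty interior and finite Haar measure is bounded. -/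
theorem Convex.isBounded_of_measure_ne_top {s : Set E} (hs : Convex ℝ s)
    (hne : (interior s).Nonempty) (hfin : μ s ≠ ∞) : Bornology.IsBounded s := by
  obtain ⟨y, hy⟩ := hne
  obtain ⟨ρ, hρ, hball⟩ := Metric.mem_nhds_iff.1 (mem_interior_iff_mem_nhds.1 hy)
  have hpos : 0 < μ (Metric.ball (0 : E) (ρ / 2)) := Metric.measure_ball_pos μ _ (by positivity)
  have hlim : Tendsto (fun n : ℕ => μ (s ∩ {x | (n : ℝ) ≤ ‖x‖})) atTop (𝓝 0) := by
    have hempty : ⋂ n : ℕ, s ∩ {x : E | (n : ℝ) ≤ ‖x‖} = ∅ := by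
      ext x
      simp only [mem_iInter, mem_inter_iff, mem_ofPred_eq, mem_empty_iff_false, iff_false,
        not_forall]
      obtain ⟨n, hn⟩ := exists_nat_gt ‖x‖
      exact ⟨n, fun h => absurd h.2 (not_le.2 hn)⟩
    have := tendsto_measure_iInter_atTop (μ := μ)
      (s := fun n : ℕ => s ∩ {x | (n : ℝ) ≤ ‖x‖})
      (fun n => (hs.nullMeasurableSet μ).inter
        (measurableSet_le measurable_const measurable_norm).nullMeasurableSet)
      (fun m n hmn x hx => ⟨hx.1, (Nat.cast_le.2 hmn).trans (mem_ofPred_eq ▸ hx.2)⟩)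
      ⟨0, measure_ne_top_of_subset inter_subset_left hfin⟩
    rwa [hempty, measure_empty] at this
  obtain ⟨n, hn⟩ := (hlim.eventually_lt_const hpos).exists
  rw [isBounded_iff_forall_norm_le]
  refine ⟨2 * (n + ρ) + ‖y‖, fun x hx => ?_⟩
  by_contra! hxn
  have hsub : Metric.ball ((2⁻¹ : ℝ) • (x + y)) (ρ / 2) ⊆ s ∩ {x | (n : ℝ) ≤ ‖x‖} := by
    intro z hz
    rw [mem_ball_iff_norm] at hz
    constructor
    · have hy' : (2 : ℝ) • z - x ∈ s := by
        apply hball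
        rw [mem_ball_iff_norm]
        have : (2 : ℝ) • z - x - y = (2 : ℝ) • (z - (2⁻¹ : ℝ) • (x + y)) := by module
        rw [this, norm_smul, Real.norm_ofNat]
        linarith
      have := hs hx hy' (a := 2⁻¹) (b := 2⁻¹) (by norm_num) (by norm_num) (by norm_num)
      convert this using 1
      module
    · have h1 : x = (2 : ℝ) • z - (2 : ℝ) • (z - (2⁻¹ : ℝ) • (x + y)) - y := by module
      have h2 : ‖x‖ ≤ 2 * ‖z‖ + 2 * ‖z - (2⁻¹ : ℝ) • (x + y)‖ + ‖y‖ := by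
        conv_lhs => rw [h1]
        refine (norm_sub_le _ _).trans (add_le_add_left ((norm_sub_le _ _).trans ?_) _)
        simp [norm_smul]
      simp only [mem_ofPred_eq]
      linarith
  have h3 := measure_mono (μ := μ) hsub
  rw [Measure.addHaar_ball_center] at h3
  exact absurd (h3.trans_lt hn) (lt_irrefl _)

/-- A property that holds almost everywhere holds along almost every nondegenerate
homothetic image. -/
theorem ae_add_smul {p : E → Prop} (h : ∀ᵐ z ∂μ, p z) (c : E) {t : ℝ} (ht : t ≠ 0) :
    ∀ᵐ y ∂μ, p (c + t • y) := by
  have h1 : μ ((fun y => t • y) ⁻¹' ((fun y => c + y) ⁻¹' {z | ¬ p z})) = 0 := by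
    rw [Measure.addHaar_preimage_smul μ ht, measure_preimage_add, ae_iff.1 h, mul_zero]
  exact h1

end ConvexGeometry

/-- If a measure is not carried by a hyperplane, closed convex sets of small Haar measure have
mass bounded away from one. -/
theorem MemP.exists_measure_convex_le {E : Type*} [NormedAddCommGroup E] [NormedSpace ℝ E]
    [FiniteDimensional ℝ E] [MeasureSpace E] [BorelSpace E]
    [(volume : Measure E).IsAddHaarMeasure] {P : Measure E} (hP : MemP P) :
    ∃ δ : ℝ, 0 < δ ∧ ∃ η : ℝ, 0 < η ∧ ∀ C : Set E, IsClosed C → Convex ℝ C →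
      volume C ≤ ENNReal.ofReal δ → ENNReal.ofReal η ≤ P Cᶜ := by
  obtain ⟨hprob, -, hhyp⟩ := hP
  by_contra! hcon
  have hex : ∀ n : ℕ, ∃ C : Set E, IsClosed C ∧ Convex ℝ C ∧
      volume C ≤ ENNReal.ofReal ((1 / 2) ^ n) ∧ P Cᶜ < ENNReal.ofReal ((1 / 2) ^ n) := by
    intro n
    obtain ⟨C, h1, h2, h3, h4⟩ := hcon ((1 / 2) ^ n) (by positivity) ((1 / 2) ^ n) (by positivity)
    exact ⟨C, h1, h2, h3, h4⟩
  choose C hclosed hconv hvol hPC using hex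
  set D : ℕ → Set E := fun m => ⋂ n ≥ m, C n with hD
  have hDconv : Convex ℝ (⋃ m, D m) := by
    refine Directed.convex_iUnion (directed_of_isDirected_le fun a b hab x hx => ?_)
      fun m => convex_iInter₂ fun n _ => hconv n
    simp only [hD, mem_iInter] at hx ⊢
    exact fun n hn => hx n (le_trans hab hn)
  have hDvol : volume (⋃ m, D m) = 0 := by
    refine measure_iUnion_null fun m => ?_
    refine le_antisymm (ge_of_tendsto (x := atTop)
      (f := fun n : ℕ => ENNReal.ofReal ((1 / 2) ^ n)) ?_ ?_) zero_le
    · rw [← ENNReal.ofReal_zero]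
      exact ENNReal.tendsto_ofReal
        (tendsto_pow_atTop_nhds_zero_of_lt_one (by norm_num) (by norm_num))
    · filter_upwards [eventually_ge_atTop m] with n hn
      exact (measure_mono (iInter₂_subset n hn)).trans (hvol n)
  have hDP : P (⋃ m, D m)ᶜ = 0 := by
    have hBC : P (limsup (fun n => (C n)ᶜ) atTop) = 0 := by
      apply measure_limsup_atTop_eq_zero
      refine ne_top_of_le_ne_top ?_ (ENNReal.tsum_le_tsum fun n => (hPC n).le)
      rw [← ENNReal.ofReal_tsum_of_nonneg (fun n => by positivity) summable_geometric_two]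
      exact ENNReal.ofReal_ne_top
    refine measure_mono_null (fun x hx => ?_) hBC
    rw [limsup_eq_iInf_iSup_of_nat]
    simp only [hD, mem_compl_iff, mem_iUnion, mem_iInter, not_exists, not_forall, iInf_eq_iInter,
      iSup_eq_iUnion] at hx ⊢
    intro m
    obtain ⟨n, hn, hxn⟩ := hx m
    exact ⟨n, hn, hxn⟩
  have hP1 : P (⋃ m, D m) = 1 := by
    exact (prob_compl_eq_zero_iff
      (MeasurableSet.iUnion fun m => MeasurableSet.biInter (to_countable _)
        fun n _ => (hclosed n).measurableSet)).1 hDP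
  have hspan : affineSpan ℝ (⋃ m, D m) ≠ ⊤ := by
    intro h
    rw [← hDconv.interior_nonempty_iff_affineSpan_eq_top] at h
    exact (isOpen_interior.measure_pos volume h).ne'
      (measure_mono_null interior_subset hDvol)
  obtain ⟨p, hp⟩ : (⋃ m, D m).Nonempty := by
    rw [nonempty_iff_ne_empty]
    intro h
    simp [h] at hP1
  set A := affineSpan ℝ (⋃ m, D m)
  have hpA : p ∈ A := subset_affineSpan ℝ _ hp
  have hdir : A.direction < ⊤ := by
    rw [lt_top_iff_ne_top, Ne, AffineSubspace.direction_eq_top_iff_of_nonempty ⟨p, hpA⟩]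
    exact hspan
  obtain ⟨l, hl, hker⟩ := Submodule.exists_le_ker_of_lt_top _ hdir
  refine (hhyp l (l p) hl).not_ge (hP1 ▸ measure_mono fun x hx => ?_)
  have := hker (AffineSubspace.vsub_mem_direction (subset_affineSpan ℝ _ hx) hpA)
  simpa [sub_eq_zero] using this

section ExtendedConcave

variable {E : Type*} [AddCommGroup E] [Module ℝ E]

/-- Concavity of an extended-real-valued function, tested on real numbers lying strictly below
its values. -/
def EConcave (φ : E → EReal) : Prop :=
  ∀ x y : E, ∀ t : ℝ, t ∈ Ioo (0 : ℝ) 1 → ∀ a b : ℝ, (a : EReal) < φ x → (b : EReal) < φ y →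
    (((1 - t) * a + t * b : ℝ) : EReal) ≤ φ ((1 - t) • x + t • y)

theorem econcave_of_forall_add_le {φ : E → EReal}
    (h : ∀ x y : E, ∀ t : ℝ, t ∈ Icc (0 : ℝ) 1 →
      ((1 - t : ℝ) : EReal) * φ x + ((t : ℝ) : EReal) * φ y ≤ φ ((1 - t) • x + t • y)) :
    EConcave φ := by
  intro x y t ht a b ha hb
  refine le_trans ?_ (h x y t (Ioo_subset_Icc_self ht))
  rw [EReal.coe_add, EReal.coe_mul, EReal.coe_mul]
  exact add_le_add
    (mul_le_mul_of_nonneg_left ha.le (EReal.coe_nonneg.2 (sub_nonneg.2 ht.2.le)))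
    (mul_le_mul_of_nonneg_left hb.le (EReal.coe_nonneg.2 ht.1.le))

theorem EConcave.add_le {φ : E → EReal} (h : EConcave φ) (htop : ∀ x, φ x ≠ ⊤) (x y : E)
    {t : ℝ} (ht : t ∈ Icc (0 : ℝ) 1) :
    ((1 - t : ℝ) : EReal) * φ x + ((t : ℝ) : EReal) * φ y ≤ φ ((1 - t) • x + t • y) := by
  rcases eq_or_lt_of_le ht.1 with rfl | h0
  · simp
  rcases eq_or_lt_of_le ht.2 with rfl | h1
  · simp
  have h1' : 0 < 1 - t := sub_pos.2 h1
  by_cases hx : φ x = ⊥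
  · rw [hx, EReal.coe_mul_bot_of_pos h1', EReal.bot_add]
    exact bot_le
  by_cases hy : φ y = ⊥
  · rw [hy, EReal.coe_mul_bot_of_pos h0, EReal.add_bot]
    exact bot_le
  lift φ x to ℝ using ⟨htop x, hx⟩ with u hu
  lift φ y to ℝ using ⟨htop y, hy⟩ with v hv
  rw [← EReal.coe_mul, ← EReal.coe_mul, ← EReal.coe_add]
  refine EReal.ge_of_forall_gt_iff_ge.1 fun c hc => ?_
  have hc' := EReal.coe_lt_coe_iff.1 hc
  have := h x y t ⟨h0, h1⟩ (u - ((1 - t) * u + t * v - c)) (v - ((1 - t) * u + t * v - c))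
    (by rw [← hu]; exact EReal.coe_lt_coe_iff.2 (by linarith))
    (by rw [← hv]; exact EReal.coe_lt_coe_iff.2 (by linarith))
  convert this using 2
  ring

theorem EConcave.convex_lt {φ : E → EReal} (h : EConcave φ) (a : EReal) :
    Convex ℝ {x | a < φ x} := by
  rw [convex_iff_forall_pos]
  intro x hx y hy s t hs ht hst
  obtain rfl : s = 1 - t := by linarith
  obtain ⟨c, hc1, hc2⟩ := EReal.lt_iff_exists_real_btwn.1 (lt_min hx hy)
  have := h x y t ⟨ht, by linarith⟩ c c (hc2.trans_le (min_le_left _ _))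
    (hc2.trans_le (min_le_right _ _))
  rw [show (1 - t) * c + t * c = c by ring] at this
  exact hc1.trans_le this

theorem EConcave.convex_le {φ : E → EReal} (h : EConcave φ) (a : EReal) :
    Convex ℝ {x | a ≤ φ x} := by
  have : {x | a ≤ φ x} = ⋂ c < a, {x | c < φ x} := by
    ext x
    simp only [mem_ofPred_eq, mem_iInter]
    exact ⟨fun h c hc => hc.trans_le h, fun h => le_of_forall_lt h⟩
  rw [this]
  exact convex_iInter₂ fun c _ => h.convex_lt c

end ExtendedConcave

section EssentialLimsup

variable {E : Type*} [TopologicalSpace E] [MeasurableSpace E] (μ : Measure E)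

/-- The essential upper semi-continuous regularisation of an extended-real-valued function. -/
def essUscReg (f : E → EReal) (x : E) : EReal := limsup f (𝓝 x ⊓ ae μ)

variable {μ}

theorem essUscReg_congr {f g : E → EReal} (h : f =ᵐ[μ] g) : essUscReg μ f = essUscReg μ g := by
  ext x
  exact limsup_congr (h.filter_mono inf_le_right)

theorem essUscReg_le_of_forall_le {f : E → EReal} {a : EReal} (h : ∀ x, f x ≤ a) (x : E) :
    essUscReg μ f x ≤ a :=
  limsup_le_of_le (by isBoundedDefault) (Eventually.of_forall h)

theorem exists_lt_of_lt_essUscReg {f : E → EReal} {x : E} {a : EReal}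
    (h : a < essUscReg μ f x) {U : Set E} (hU : U ∈ 𝓝 x) {p : E → Prop} (hp : ∀ᵐ y ∂μ, p y) :
    ∃ y ∈ U, p y ∧ a < f y := by
  have hf : ∃ᶠ y in 𝓝 x ⊓ ae μ, a < f y := frequently_lt_of_lt_limsup (by isBoundedDefault) h
  obtain ⟨y, hy, h1, h2⟩ := (hf.and_eventually
    ((eventually_mem_set.2 hU).filter_mono inf_le_left |>.and
      (hp.filter_mono inf_le_right))).exists
  exact ⟨y, h1, h2, hy⟩

theorem le_essUscReg {f : E → EReal} {x : E} {a : EReal}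
    (h : ∀ U ∈ 𝓝 x, ∀ p : E → Prop, (∀ᵐ y ∂μ, p y) → ∃ y ∈ U, p y ∧ a ≤ f y) :
    a ≤ essUscReg μ f x := by
  refine le_limsup_of_frequently_le' ?_
  rw [frequently_iff]
  intro s hs
  obtain ⟨U, hU, V, hV, rfl⟩ := mem_inf_iff.1 hs
  obtain ⟨y, hyU, hyV, hy⟩ := h U hU (· ∈ V) hV
  exact ⟨y, ⟨hyU, hyV⟩, hy⟩

theorem upperSemicontinuous_essUscReg (f : E → EReal) : UpperSemicontinuous (essUscReg μ f) := by
  intro x a ha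
  obtain ⟨b, hb, hba⟩ := exists_between ha
  have h1 : ∀ᶠ y in 𝓝 x ⊓ ae μ, f y < b := eventually_lt_of_limsup_lt hb
  obtain ⟨U, hU, V, hV, hUV⟩ := mem_inf_iff.1 h1
  filter_upwards [eventually_eventually_nhds.2 hU] with y hy
  refine lt_of_le_of_lt (limsup_le_of_le (by isBoundedDefault) ?_) hba
  have h2 : U ∩ V ∈ 𝓝 y ⊓ ae μ := inter_mem_inf hy hV
  rw [← hUV] at h2
  filter_upwards [h2] with z hz using le_of_lt hz

theorem essUscReg_le_of_upperSemicontinuous {f : E → EReal} (hf : UpperSemicontinuous f) (x : E) :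
    essUscReg μ f x ≤ f x := by
  refine le_of_forall_gt fun a ha => ?_
  obtain ⟨b, hb, hba⟩ := exists_between ha
  refine lt_of_le_of_lt (limsup_le_of_le (by isBoundedDefault) ?_) hba
  exact ((hf x b hb).filter_mono inf_le_left).mono fun y hy => le_of_lt hy

end EssentialLimsup

section ConcaveLimits

variable {E : Type*} [NormedAddCommGroup E] [NormedSpace ℝ E] [FiniteDimensional ℝ E]
  [MeasurableSpace E] [BorelSpace E] {μ : Measure E} [μ.IsAddHaarMeasure]
  {φ : ℕ → E → EReal} {f : E → EReal}

/-- The essential regularisation of an almost everywhere limit of concave functions dominates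
their pointwise upper limit, everywhere. -/
theorem limsup_le_essUscReg (hφ : ∀ n, EConcave (φ n))
    (hlim : ∀ᵐ x ∂μ, Tendsto (fun n => φ n x) atTop (𝓝 (f x)))
    (hpos : ¬ ∀ᵐ x ∂μ, f x = ⊥) (x : E) :
    limsup (fun n => φ n x) atTop ≤ essUscReg μ f x := by
  refine le_of_forall_lt fun a₀ ha₀ => ?_
  obtain ⟨a', ha₀', ha'⟩ := EReal.lt_iff_exists_real_btwn.1 ha₀
  obtain ⟨a, haa', ha⟩ := EReal.lt_iff_exists_real_btwn.1 ha'
  have hfreq : ∃ᶠ n in atTop, (a : EReal) < φ n x :=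
    frequently_lt_of_lt_limsup (by isBoundedDefault) ha
  refine ha₀'.trans_le (le_essUscReg fun U hU p hp => ?_)
  have hseq : ∀ᵐ y ∂μ, ∀ k : ℕ,
      p ((1 - 1 / ((k : ℝ) + 2)) • x + (1 / ((k : ℝ) + 2)) • y) ∧
      Tendsto (fun n => φ n ((1 - 1 / ((k : ℝ) + 2)) • x + (1 / ((k : ℝ) + 2)) • y)) atTop
        (𝓝 (f ((1 - 1 / ((k : ℝ) + 2)) • x + (1 / ((k : ℝ) + 2)) • y))) := by
    rw [ae_all_iff]
    exact fun k => ae_add_smul μ (hp.and hlim) _ (by positivity)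
  obtain ⟨y, hy, hylim, hyseq⟩ := ((not_eventually.1 hpos).and_eventually (hlim.and hseq)).exists
  obtain ⟨b, -, hb⟩ := EReal.lt_iff_exists_real_btwn.1 (bot_lt_iff_ne_bot.2 hy)
  have ht : Tendsto (fun k : ℕ => 1 / ((k : ℝ) + 2)) atTop (𝓝 0) := by
    simp only [one_div]
    exact (tendsto_atTop_add_const_right _ _ tendsto_natCast_atTop_atTop).inv_tendsto_atTop
  have hz : Tendsto (fun k : ℕ => (1 - 1 / ((k : ℝ) + 2)) • x + (1 / ((k : ℝ) + 2)) • y) atTop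
      (𝓝 x) := by
    simpa using (((tendsto_const_nhds (x := (1 : ℝ))).sub ht).smul_const x).add (ht.smul_const y)
  have hc : Tendsto (fun k : ℕ => (1 - 1 / ((k : ℝ) + 2)) * a + (1 / ((k : ℝ) + 2)) * b) atTop
      (𝓝 a) := by
    simpa using (((tendsto_const_nhds (x := (1 : ℝ))).sub ht).mul_const a).add (ht.mul_const b)
  obtain ⟨k, hkU, hka⟩ := ((hz.eventually_mem hU).and
    (hc.eventually_const_lt (EReal.coe_lt_coe_iff.1 haa'))).exists
  refine ⟨_, hkU, (hyseq k).1, ?_⟩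
  refine ge_of_tendsto_of_frequently (hyseq k).2 ?_
  refine (hfreq.and_eventually (hylim.eventually_const_lt hb)).mono fun n hn => ?_
  refine le_trans (EReal.coe_le_coe_iff.2 hka.le) (hφ n x y _ ⟨by positivity, ?_⟩ a b hn.1 hn.2)
  rw [div_lt_one (by positivity)]
  linarith [Nat.cast_nonneg (α := ℝ) k]

theorem econcave_essUscReg (hφ : ∀ n, EConcave (φ n))
    (hlim : ∀ᵐ x ∂μ, Tendsto (fun n => φ n x) atTop (𝓝 (f x))) :
    EConcave (essUscReg μ f) := by
  intro x y t ht a b ha hb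
  refine le_essUscReg fun U hU p hp => ?_
  have hcont : Tendsto (fun q : E × E => (1 - t) • q.1 + t • q.2) (𝓝 x ×ˢ 𝓝 y)
      (𝓝 ((1 - t) • x + t • y)) := by
    rw [← nhds_prod_eq]
    exact Continuous.tendsto (by fun_prop) (x, y)
  obtain ⟨V, hV, W, hW, hVW⟩ := mem_prod_iff.1 (hcont hU)
  obtain ⟨x', hx'V, hx'lim, hx'⟩ := exists_lt_of_lt_essUscReg ha hV hlim
  obtain ⟨y', hy'W, ⟨hy'lim, hz⟩, hy'⟩ := exists_lt_of_lt_essUscReg hb hW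
    (hlim.and (ae_add_smul μ (hp.and hlim) ((1 - t) • x') ht.1.ne'))
  refine ⟨_, hVW (mk_mem_prod hx'V hy'W), hz.1, ge_of_tendsto hz.2 ?_⟩
  filter_upwards [hx'lim.eventually_const_lt hx', hy'lim.eventually_const_lt hy'] with n h1 h2
  exact hφ n x' y' t ht a b h1 h2

theorem essUscReg_le_ae (hφ : ∀ n, EConcave (φ n))
    (hlim : ∀ᵐ x ∂μ, Tendsto (fun n => φ n x) atTop (𝓝 (f x))) :
    ∀ᵐ x ∂μ, essUscReg μ f x ≤ f x := by
  have hfront : ∀ᵐ x ∂μ, ∀ q : ℚ, x ∉ frontier {x | ((q : ℝ) : EReal) < essUscReg μ f x} := by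
    rw [ae_all_iff]
    intro q
    exact measure_eq_zero_iff_ae_notMem.1
      (((econcave_essUscReg hφ hlim).convex_lt _).addHaar_frontier μ)
  filter_upwards [hfront, hlim] with x hx hxlim
  refine le_of_forall_lt fun a₀ ha₀ => ?_
  obtain ⟨q, haq, hq⟩ := EReal.lt_iff_exists_rat_btwn.1 ha₀
  refine haq.trans_le ?_
  set L := {x | ((q : ℝ) : EReal) < essUscReg μ f x} with hL
  have hxL : x ∈ interior L := by
    by_contra h
    exact hx q ⟨subset_closure hq, h⟩
  set S := {y | Tendsto (fun n => φ n y) atTop (𝓝 (f y)) ∧ ((q : ℝ) : EReal) < f y} with hS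
  have hLS : L ⊆ closure S := by
    intro y hy
    rw [mem_closure_iff_nhds]
    intro U hU
    obtain ⟨z, hzU, hz1, hz2⟩ := exists_lt_of_lt_essUscReg hy hU hlim
    exact ⟨z, hzU, hz1, hz2⟩
  have hxS : x ∈ convexHull ℝ S := (convex_convexHull ℝ S).interior_closure_subset
    (interior_mono (hLS.trans (closure_mono (subset_convexHull ℝ S))) hxL)
  rw [convexHull_eq_union_convexHull_finite_subsets] at hxS
  simp only [mem_iUnion] at hxS
  obtain ⟨T, hTS, hxT⟩ := hxS
  refine ge_of_tendsto hxlim ?_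
  have hev : ∀ᶠ n in atTop, ∀ y ∈ T, ((q : ℝ) : EReal) < φ n y := by
    rw [Filter.eventually_all_finset]
    exact fun y hy => (hTS hy).1.eventually_const_lt (hTS hy).2
  filter_upwards [hev] with n hn
  have hsub : convexHull ℝ (T : Set E) ⊆ {y | ((q : ℝ) : EReal) < φ n y} :=
    convexHull_min hn ((hφ n).convex_lt _)
  exact (mem_ofPred_eq ▸ hsub hxT).le

end ConcaveLimits

section Coercivity

theorem exp_mul_measure_le_lintegral {α : Type*} [MeasurableSpace α] {μ : Measure α}
    {φ : α → EReal} (hφ : Measurable φ) (r : EReal) :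
    r.exp * μ {x | r ≤ φ x} ≤ ∫⁻ x, (φ x).exp ∂μ := by
  have := mul_meas_ge_le_lintegral (μ := μ) hφ.ereal_exp r.exp
  simpa only [EReal.exp_le_exp_iff] using this

/-- A concave function that is not almost everywhere `-∞` and whose exponential is integrable
tends to `-∞` at infinity. -/
theorem EConcave.tendsto_bot {E : Type*} [NormedAddCommGroup E] [NormedSpace ℝ E]
    [FiniteDimensional ℝ E] [MeasurableSpace E] [BorelSpace E] {μ : Measure E}
    [μ.IsAddHaarMeasure] {φ : E → EReal} (hφ : EConcave φ)
    (hmeas : Measurable φ) (hpos : ¬ ∀ᵐ x ∂μ, φ x = ⊥) (hint : ∫⁻ x, (φ x).exp ∂μ ≠ ∞) :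
    Tendsto φ (comap (fun x => ‖x‖) atTop) (𝓝 ⊥) := by
  have hk : ∃ k : ℕ, μ {x | ((-(k : ℝ) : ℝ) : EReal) ≤ φ x} ≠ 0 := by
    by_contra! h
    refine hpos (measure_mono_null (fun x hx => ?_) (measure_iUnion_null h))
    obtain ⟨b, -, hb⟩ := EReal.lt_iff_exists_real_btwn.1 (bot_lt_iff_ne_bot.2 hx)
    obtain ⟨k, hk⟩ := exists_nat_ge (-b)
    exact mem_iUnion.2 ⟨k, (EReal.coe_le_coe_iff.2 (by linarith)).trans hb.le⟩
  obtain ⟨k, hk⟩ := hk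
  rw [EReal.tendsto_nhds_bot_iff_real]
  intro r
  set r' := min r (-k) with hr'
  have hbdd : Bornology.IsBounded {x | (r' : EReal) ≤ φ x} := by
    refine Convex.isBounded_of_measure_ne_top μ (hφ.convex_le _)
      ((hφ.convex_le _).interior_nonempty_of_measure_ne_zero μ ?_) ?_
    · refine fun h => hk (measure_mono_null (fun x hx => ?_) h)
      exact (EReal.coe_le_coe_iff.2 (min_le_right _ _)).trans hx
    · intro h
      have := exp_mul_measure_le_lintegral (μ := μ) hmeas (r' : EReal)
      rw [h, ENNReal.mul_top (by simp [Real.exp_pos])] at this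
      exact hint (top_le_iff.1 this)
  rw [comap_norm_atTop]
  filter_upwards [Bornology.isBounded_def.1 hbdd] with x hx
  rw [mem_compl_iff, mem_ofPred_eq, not_le] at hx
  exact hx.trans_le (EReal.coe_le_coe_iff.2 (min_le_left _ _))

end Coercivity

section ClassPhi

variable {E : Type*} [NormedAddCommGroup E] [NormedSpace ℝ E]

theorem MemPhi.econcave {φ : E → EReal} (hφ : MemPhi φ) : EConcave φ :=
  econcave_of_forall_add_le hφ.2.2.1

theorem MemPhi.measurable [MeasurableSpace E] [BorelSpace E] {φ : E → EReal} (hφ : MemPhi φ) :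
    Measurable φ :=
  hφ.2.1.measurable

theorem MemPhi.isClosed_le {φ : E → EReal} (hφ : MemPhi φ) (a : EReal) :
    IsClosed {x | a ≤ φ x} :=
  hφ.2.1.isClosed_preimage a

theorem MemPhi.exists_forall_le [FiniteDimensional ℝ E] {φ : E → EReal} (hφ : MemPhi φ) :
    ∃ x₀, ∀ x, φ x ≤ φ x₀ := by
  by_cases h : ∀ x, φ x = ⊥
  · exact ⟨0, fun x => by simp [h]⟩
  obtain ⟨y, hy⟩ := not_forall.1 h
  have hev := hφ.2.2.2.eventually_lt_const (bot_lt_iff_ne_bot.2 hy)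
  rw [comap_norm_atTop, Metric.cobounded_eq_cocompact, eventually_iff] at hev
  obtain ⟨K, hK, hKs⟩ := mem_cocompact.1 hev
  have hlt : ∀ x ∉ K, φ x < φ y := fun x hx => by simpa only [mem_ofPred_eq] using hKs hx
  have hyK : y ∈ K := by
    by_contra hyK
    exact lt_irrefl _ (hlt y hyK)
  obtain ⟨x₀, -, hx₀⟩ := (hφ.2.1.upperSemicontinuousOn K).exists_isMaxOn ⟨y, hyK⟩ hK
  refine ⟨x₀, fun x => ?_⟩
  by_cases hx : x ∈ K
  · exact hx₀ hx
  · exact (hlt x hx).le.trans (hx₀ hyK)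

theorem MemPhi.exists_real_ge [FiniteDimensional ℝ E] {φ : E → EReal} (hφ : MemPhi φ) :
    ∃ M : ℝ, ∀ x, φ x ≤ M := by
  obtain ⟨x₀, h⟩ := hφ.exists_forall_le
  obtain ⟨M, hM, -⟩ := EReal.lt_iff_exists_real_btwn.1 (lt_top_iff_ne_top.2 (hφ.1 x₀))
  exact ⟨M, fun x => (h x).trans hM.le⟩

/-- The midpoint of two extended real numbers. -/
def emid (a b : EReal) : EReal := ((2⁻¹ : ℝ) : EReal) * a + ((2⁻¹ : ℝ) : EReal) * b

@[simp] theorem emid_bot_left (b : EReal) : emid ⊥ b = ⊥ := by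
  rw [emid, EReal.coe_mul_bot_of_pos (by norm_num), EReal.bot_add]

@[simp] theorem emid_bot_right (a : EReal) : emid a ⊥ = ⊥ := by
  rw [emid, EReal.coe_mul_bot_of_pos (by norm_num), EReal.add_bot]

@[simp] theorem emid_coe (a b : ℝ) : emid a b = ((a + b) / 2 : ℝ) := by
  rw [emid, ← EReal.coe_mul, ← EReal.coe_mul, ← EReal.coe_add]
  congr 1
  ring

theorem emid_le {a b c : EReal} (ha : a ≤ c) (hb : b ≤ c) (hc : c ≠ ⊤) : emid a b ≤ c := by
  induction a with
  | bot => simp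
  | top => exact absurd (top_le_iff.1 ha) hc
  | coe a =>
    induction b with
    | bot => simp
    | top => exact absurd (top_le_iff.1 hb) hc
    | coe b =>
      induction c with
      | bot => simp at ha
      | top => exact absurd rfl hc
      | coe c =>
        rw [emid_coe]
        rw [EReal.coe_le_coe_iff] at *
        linarith

theorem emid_ne_top {a b : EReal} (ha : a ≠ ⊤) (hb : b ≠ ⊤) : emid a b ≠ ⊤ := by
  induction a with
  | bot => simp
  | top => exact absurd rfl ha
  | coe a =>
    induction b with
    | bot => simp
    | top => exact absurd rfl hb
    | coe b => simp

theorem MemPhi.emid {φ ψ : E → EReal} (hφ : MemPhi φ) (hψ : MemPhi ψ) :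
    MemPhi fun x => emid (φ x) (ψ x) := by
  have hmul : Continuous fun a : EReal => ((2⁻¹ : ℝ) : EReal) * a := by
    refine continuous_iff_continuousAt.2 fun a => ?_
    have h0 : ((2⁻¹ : ℝ) : EReal) ≠ 0 := EReal.coe_ne_zero.2 (by norm_num)
    exact (EReal.continuousAt_mul (p := (((2⁻¹ : ℝ) : EReal), a)) (.inl h0) (.inl h0)
      (.inl (EReal.coe_ne_bot _)) (.inl (EReal.coe_ne_top _))).comp
      (f := fun a => (((2⁻¹ : ℝ) : EReal), a)) (by fun_prop)
  have hmono : Monotone fun a : EReal => ((2⁻¹ : ℝ) : EReal) * a :=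
    fun a b hab => mul_le_mul_of_nonneg_left hab (EReal.coe_nonneg.2 (by norm_num))
  have htop : ∀ a : EReal, a ≠ ⊤ → ((2⁻¹ : ℝ) : EReal) * a ≠ ⊤ := by
    intro a ha
    induction a with
    | bot => rw [EReal.coe_mul_bot_of_pos (by norm_num)]; exact bot_ne_top
    | top => exact absurd rfl ha
    | coe a => rw [← EReal.coe_mul]; exact EReal.coe_ne_top _
  have hne : ∀ x, _root_.emid (φ x) (ψ x) ≠ ⊤ := fun x => emid_ne_top (hφ.1 x) (hψ.1 x)
  refine ⟨hne, ?_, fun x y t ht => EConcave.add_le ?_ hne x y ht, ?_⟩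
  · exact (hmul.comp_upperSemicontinuous hφ.2.1 hmono).add'
      (hmul.comp_upperSemicontinuous hψ.2.1 hmono) fun x =>
        EReal.continuousAt_add (.inl (htop _ (hφ.1 x))) (.inr (htop _ (hψ.1 x)))
  · intro x y t ht a b ha hb
    have key : ∀ z, ∀ c : ℝ, (c : EReal) < _root_.emid (φ z) (ψ z) →
        ∃ u v : ℝ, φ z = u ∧ ψ z = v ∧ c < (u + v) / 2 := by
      intro z c hc
      have h1 : φ z ≠ ⊥ := fun h => by simp [h] at hc
      have h2 : ψ z ≠ ⊥ := fun h => by simp [h] at hc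
      refine ⟨(φ z).toReal, (ψ z).toReal, (EReal.coe_toReal (hφ.1 z) h1).symm,
        (EReal.coe_toReal (hψ.1 z) h2).symm, ?_⟩
      rwa [← EReal.coe_toReal (hφ.1 z) h1, ← EReal.coe_toReal (hψ.1 z) h2, emid_coe,
        EReal.coe_lt_coe_iff] at hc
    obtain ⟨u, v, hu, hv, hc⟩ := key x a ha
    obtain ⟨u', v', hu', hv', hc'⟩ := key y b hb
    have h1 := hφ.2.2.1 x y t (Ioo_subset_Icc_self ht)
    have h2 := hψ.2.2.1 x y t (Ioo_subset_Icc_self ht)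
    rw [hu, hu', ← EReal.coe_mul, ← EReal.coe_mul, ← EReal.coe_add] at h1
    rw [hv, hv', ← EReal.coe_mul, ← EReal.coe_mul, ← EReal.coe_add] at h2
    refine le_trans ?_ (add_le_add (hmono h1) (hmono h2))
    simp only
    rw [← EReal.coe_mul, ← EReal.coe_mul, ← EReal.coe_add, EReal.coe_le_coe_iff]
    have := mul_le_mul_of_nonneg_left hc.le (sub_nonneg.2 ht.2.le)
    have := mul_le_mul_of_nonneg_left hc'.le ht.1.le
    linarith
  · rw [EReal.tendsto_nhds_bot_iff_real]
    intro r
    filter_upwards [EReal.tendsto_nhds_bot_iff_real.1 hφ.2.2.2 (r - 1),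
      EReal.tendsto_nhds_bot_iff_real.1 hψ.2.2.2 (r - 1)] with x h1 h2
    exact (emid_le h1.le h2.le (EReal.coe_ne_top _)).trans_lt
      (EReal.coe_lt_coe_iff.2 (by linarith))

end ClassPhi

section Integrands

theorem epos_eq_toENNReal (a : EReal) : epos a = a.toENNReal := rfl

theorem expE_eq_exp (a : EReal) : expE a = a.exp := by
  induction a with
  | bot => simp [expE]
  | top => simp [expE]
  | coe a => simp [expE]

/-- The amount by which an extended real number falls short of a real bound. -/
def deficit (M : ℝ) (a : EReal) : ℝ≥0∞ := ((M : EReal) - a).toENNReal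

@[simp] theorem deficit_bot (M : ℝ) : deficit M ⊥ = ∞ := by simp [deficit]

@[simp] theorem deficit_coe (M a : ℝ) : deficit M a = ENNReal.ofReal (M - a) := by
  rw [deficit, ← EReal.coe_sub, EReal.real_coe_toENNReal]

theorem continuous_deficit (M : ℝ) : Continuous (deficit M) := by
  refine EReal.continuous_toENNReal.comp (continuous_iff_continuousAt.2 fun a => ?_)
  change ContinuousAt (fun a : EReal => (M : EReal) + -a) a
  exact (EReal.continuousAt_add (p := ((M : EReal), -a)) (.inl (EReal.coe_ne_top _))
    (.inl (EReal.coe_ne_bot _))).comp (f := fun a => ((M : EReal), -a))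
      (continuousAt_const.prodMk continuous_neg.continuousAt)

theorem measurable_deficit (M : ℝ) : Measurable (deficit M) := (continuous_deficit M).measurable

theorem antitone_deficit (M : ℝ) : Antitone (deficit M) := fun _ _ hab =>
  EReal.toENNReal_le_toENNReal (EReal.sub_le_sub le_rfl hab)

theorem deficit_add_toENNReal {M : ℝ} (hM : 0 ≤ M) {a : EReal} (ha : a ≤ M) :
    deficit M a + a.toENNReal = ENNReal.ofReal M + (-a).toENNReal := by
  induction a with
  | bot => simp
  | top => simp at ha
  | coe a =>
    have ha' := EReal.coe_le_coe_iff.1 ha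
    rw [deficit_coe, ← EReal.coe_neg, EReal.real_coe_toENNReal, EReal.real_coe_toENNReal]
    rcases le_total 0 a with h | h
    · rw [ENNReal.ofReal_of_nonpos (neg_nonpos.2 h), add_zero,
        ← ENNReal.ofReal_add (by linarith) h, sub_add_cancel]
    · rw [ENNReal.ofReal_of_nonpos h, add_zero, ← ENNReal.ofReal_add hM (by linarith),
        sub_eq_add_neg]

theorem deficit_emid {M : ℝ} {a b : EReal} (ha : a ≤ M) (hb : b ≤ M) :
    deficit M (emid a b) = 2⁻¹ * deficit M a + 2⁻¹ * deficit M b := by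
  induction a with
  | bot => simp [ENNReal.mul_top]
  | top => simp at ha
  | coe a =>
    induction b with
    | bot => simp [ENNReal.mul_top]
    | top => simp at hb
    | coe b =>
      have ha' := EReal.coe_le_coe_iff.1 ha
      have hb' := EReal.coe_le_coe_iff.1 hb
      have h2 : (2⁻¹ : ℝ≥0∞) = ENNReal.ofReal 2⁻¹ := by
        rw [ENNReal.ofReal_inv_of_pos two_pos, ENNReal.ofReal_ofNat]
      rw [emid_coe, deficit_coe, deficit_coe, deficit_coe, h2,
        ← ENNReal.ofReal_mul (by norm_num), ← ENNReal.ofReal_mul (by norm_num),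
        ← ENNReal.ofReal_add (by linarith) (by linarith)]
      congr 1
      ring

/-- The square root of the exponential of an extended real number. -/
def sqrtExp (a : EReal) : ℝ := √a.exp.toReal

@[simp] theorem sqrtExp_bot : sqrtExp ⊥ = 0 := by simp [sqrtExp]

theorem sqrtExp_coe (a : ℝ) : sqrtExp a = Real.exp (a / 2) := by
  rw [sqrtExp, EReal.exp_coe, ENNReal.toReal_ofReal (Real.exp_nonneg a),
    Real.exp_half]

theorem measurable_sqrtExp : Measurable sqrtExp :=
  (EReal.measurable_exp.ennreal_toReal).sqrt

theorem log_ofReal_sqrtExp_sq {a : EReal} (ha : a ≠ ⊤) :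
    ENNReal.log (ENNReal.ofReal (sqrtExp a ^ 2)) = a := by
  rw [sqrtExp, Real.sq_sqrt ENNReal.toReal_nonneg, ENNReal.ofReal_toReal (by simpa using ha),
    EReal.log_exp]

theorem enorm_sqrtExp_sq {a : EReal} (ha : a ≠ ⊤) : ‖sqrtExp a‖ₑ ^ 2 = a.exp := by
  rw [← enorm_pow, Real.enorm_of_nonneg (by positivity), sqrtExp,
    Real.sq_sqrt ENNReal.toReal_nonneg, ENNReal.ofReal_toReal (by simpa using ha)]

theorem exp_emid_add {a b : EReal} (ha : a ≠ ⊤) (hb : b ≠ ⊤) :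
    (emid a b).exp + 2⁻¹ * ‖sqrtExp a - sqrtExp b‖ₑ ^ 2 = 2⁻¹ * a.exp + 2⁻¹ * b.exp := by
  induction a with
  | bot => simp [← enorm_sqrtExp_sq hb]
  | top => exact absurd rfl ha
  | coe a =>
    induction b with
    | bot => simp [← enorm_sqrtExp_sq ha]
    | top => exact absurd rfl hb
    | coe b =>
      have h2 : (2⁻¹ : ℝ≥0∞) = ENNReal.ofReal 2⁻¹ := by
        rw [ENNReal.ofReal_inv_of_pos two_pos, ENNReal.ofReal_ofNat]
      have hsq : ∀ c : ℝ, Real.exp c = Real.exp (c / 2) ^ 2 := fun c => by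
        rw [← Real.exp_nat_mul]
        congr 1
        push_cast
        ring
      rw [emid_coe, sqrtExp_coe, sqrtExp_coe, EReal.exp_coe, EReal.exp_coe, EReal.exp_coe, h2,
        ← enorm_norm, ← enorm_pow, Real.enorm_of_nonneg (by positivity), Real.norm_eq_abs, sq_abs,
        ← ENNReal.ofReal_mul (by norm_num), ← ENNReal.ofReal_mul (by norm_num),
        ← ENNReal.ofReal_mul (by norm_num), ← ENNReal.ofReal_add (by positivity) (by positivity),
        ← ENNReal.ofReal_add (by positivity) (by positivity), hsq a, hsq b,
        show (a + b) / 2 = a / 2 + b / 2 by ring, Real.exp_add]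
      congr 1
      ring

end Integrands

section Functional

variable {E : Type*} [MeasureSpace E]

/-- The functional `M - L(φ, P)`, which is a sum of integrals of nonnegative functions as soon as
`φ ≤ M`. -/
def coLfun (M : ℝ) (φ : E → EReal) (P : Measure E) : ℝ≥0∞ :=
  ∫⁻ x, deficit M (φ x) ∂P + ∫⁻ x, (φ x).exp

theorem Lfun_eq [NormedAddCommGroup E] [NormedSpace ℝ E] {P : Measure E} [IsProbabilityMeasure P] {M : ℝ} (hM : 0 ≤ M) {φ : E → EReal}
    (hmeas : Measurable φ) (hφ : ∀ x, φ x ≤ M) :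
    Lfun φ P = (M : EReal) - (coLfun M φ P : EReal) := by
  have h1 : ∫⁻ x, deficit M (φ x) ∂P + ∫⁻ x, (φ x).toENNReal ∂P
      = ENNReal.ofReal M + ∫⁻ x, (-φ x).toENNReal ∂P := by
    rw [← lintegral_add_right _ hmeas.ereal_toENNReal]
    simp_rw [fun x => deficit_add_toENNReal hM (hφ x)]
    rw [lintegral_add_left measurable_const, lintegral_const, measure_univ, mul_one]
  have h2 : ∫⁻ x, (φ x).toENNReal ∂P ≠ ∞ := by
    refine ne_top_of_le_ne_top (ENNReal.ofReal_ne_top (r := M))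
      ((lintegral_mono fun x => EReal.toENNReal_le_toENNReal (hφ x)).trans_eq ?_)
    rw [lintegral_const, measure_univ, mul_one, EReal.real_coe_toENNReal]
  simp only [Lfun, erealIntegral, epos_eq_toENNReal, expE_eq_exp, coLfun]
  generalize (∫⁻ x, deficit M (φ x) ∂P) = N at *
  generalize (∫⁻ x, (φ x).toENNReal ∂P) = A at *
  generalize (∫⁻ x, (-φ x).toENNReal ∂P) = B at *
  generalize (∫⁻ x, (φ x).exp) = I at *
  have hN : N = ∞ ↔ B = ∞ := by
    constructor
    · rintro rfl
      simpa using h1.symm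
    · rintro rfl
      simpa [h2] using h1
  by_cases hI : I = ∞
  · simp [hI, EReal.sub_top]
  by_cases hB : B = ∞
  · simp [hB, hN.2 hB, EReal.sub_top]
  have hN' : N ≠ ∞ := fun h => hB (hN.1 h)
  lift N to NNReal using hN'
  lift B to NNReal using hB
  lift I to NNReal using hI
  lift A to NNReal using h2
  have h3 := congrArg ENNReal.toReal h1
  rw [ENNReal.toReal_add ENNReal.coe_ne_top ENNReal.coe_ne_top,
    ENNReal.toReal_add ENNReal.ofReal_ne_top ENNReal.coe_ne_top, ENNReal.toReal_ofReal hM] at h3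
  simp only [ENNReal.coe_toReal] at h3
  have hc : ∀ a : NNReal, ((a : ℝ≥0∞) : EReal) = ((a : ℝ) : EReal) := fun a => rfl
  rw [EReal.coe_ennreal_add, hc, hc, hc, hc, ← EReal.coe_add, ← EReal.coe_sub, ← EReal.coe_sub,
    ← EReal.coe_sub]
  congr 1
  linarith

theorem coLfun_emid_add {P : Measure E} {M : ℝ} {φ ψ : E → EReal}
    (hφm : Measurable φ) (hψm : Measurable ψ) (hφ : ∀ x, φ x ≤ M) (hψ : ∀ x, ψ x ≤ M) :
    coLfun M (fun x => emid (φ x) (ψ x)) P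
      + 2⁻¹ * ∫⁻ x, ‖sqrtExp (φ x) - sqrtExp (ψ x)‖ₑ ^ 2
      = 2⁻¹ * coLfun M φ P + 2⁻¹ * coLfun M ψ P := by
  have hlt : ((M : ℝ) : EReal) < ⊤ := EReal.coe_lt_top M
  have hm1 : Measurable fun x => ‖sqrtExp (φ x) - sqrtExp (ψ x)‖ₑ ^ 2 :=
    ((measurable_sqrtExp.comp hφm).sub (measurable_sqrtExp.comp hψm)).enorm.pow_const 2
  have h1 : ∫⁻ x, deficit M (emid (φ x) (ψ x)) ∂P
      = 2⁻¹ * ∫⁻ x, deficit M (φ x) ∂P + 2⁻¹ * ∫⁻ x, deficit M (ψ x) ∂P := by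
    have hd1 : Measurable fun x => deficit M (φ x) := (measurable_deficit M).comp hφm
    have hd2 : Measurable fun x => deficit M (ψ x) := (measurable_deficit M).comp hψm
    rw [← lintegral_const_mul _ hd1, ← lintegral_const_mul _ hd2,
      ← lintegral_add_left (hd1.const_mul _)]
    exact lintegral_congr fun x => deficit_emid (hφ x) (hψ x)
  have h2 : (∫⁻ x, (emid (φ x) (ψ x)).exp)
        + 2⁻¹ * (∫⁻ x, ‖sqrtExp (φ x) - sqrtExp (ψ x)‖ₑ ^ 2)
      = 2⁻¹ * (∫⁻ x, (φ x).exp) + 2⁻¹ * (∫⁻ x, (ψ x).exp) := by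
    rw [← lintegral_const_mul _ hm1, ← lintegral_add_right _ (hm1.const_mul _),
      ← lintegral_const_mul _ hφm.ereal_exp, ← lintegral_const_mul _ hψm.ereal_exp,
      ← lintegral_add_left (hφm.ereal_exp.const_mul _)]
    exact lintegral_congr fun x =>
      exp_emid_add ((hφ x).trans_lt hlt).ne ((hψ x).trans_lt hlt).ne
  rw [coLfun, coLfun, coLfun, add_assoc, h2, h1]
  ring

end Functional

theorem memPhi_neg_norm {E : Type*} [NormedAddCommGroup E] [NormedSpace ℝ E] :
    MemPhi fun x : E => ((-‖x‖ : ℝ) : EReal) := by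
  refine ⟨fun x => EReal.coe_ne_top _, ?_, fun x y t ht => ?_, ?_⟩
  · exact (continuous_coe_real_ereal.comp continuous_norm.neg).upperSemicontinuous
  · rw [← EReal.coe_mul, ← EReal.coe_mul, ← EReal.coe_add, EReal.coe_le_coe_iff]
    have := norm_add_le ((1 - t) • x) (t • y)
    rw [norm_smul, norm_smul, Real.norm_of_nonneg ht.1,
      Real.norm_of_nonneg (sub_nonneg.2 ht.2)] at this
    linarith
  · exact EReal.tendsto_coe_atBot.comp (tendsto_neg_atTop_atBot.comp tendsto_comap)

section Coercivity

variable {E : Type*} [NormedAddCommGroup E] [NormedSpace ℝ E] [MeasureSpace E] [BorelSpace E]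
  {P : Measure E} {δ η : ℝ}

theorem MemPhi.ofReal_le_lintegral_deficit
    (h : ∀ C : Set E, IsClosed C → Convex ℝ C → volume C ≤ ENNReal.ofReal δ →
      ENNReal.ofReal η ≤ P Cᶜ) {φ : E → EReal} (hφ : MemPhi φ) {M s : ℝ} (hs : 0 ≤ s)
    (hv : volume {x | ((M - s : ℝ) : EReal) ≤ φ x} ≤ ENNReal.ofReal δ) :
    ENNReal.ofReal (s * η) ≤ ∫⁻ x, deficit M (φ x) ∂P := by
  have hd : Measurable fun x => deficit M (φ x) := (measurable_deficit M).comp hφ.measurable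
  have hsub : {x | ((M - s : ℝ) : EReal) ≤ φ x}ᶜ ⊆ {x | ENNReal.ofReal s ≤ deficit M (φ x)} := by
    intro x hx
    rw [mem_compl_iff, mem_ofPred_eq, not_le] at hx
    rw [mem_ofPred_eq]
    have := antitone_deficit M hx.le
    rwa [deficit_coe, sub_sub_cancel] at this
  rw [ENNReal.ofReal_mul hs]
  calc ENNReal.ofReal s * ENNReal.ofReal η
      ≤ ENNReal.ofReal s * P {x | ENNReal.ofReal s ≤ deficit M (φ x)} := by
        gcongr
        exact (h _ (hφ.isClosed_le _) (hφ.econcave.convex_le _) hv).trans (measure_mono hsub)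
    _ ≤ _ := mul_meas_ge_le_lintegral hd _

theorem exists_forall_le_lintegral_exp (hδ : 0 < δ) (hη : 0 < η)
    (h : ∀ C : Set E, IsClosed C → Convex ℝ C → volume C ≤ ENNReal.ofReal δ →
      ENNReal.ofReal η ≤ P Cᶜ) (M : ℝ) {K : ℝ} (hK : 0 ≤ K) :
    ∃ c : ℝ≥0∞, 0 < c ∧ ∀ φ : E → EReal, MemPhi φ → coLfun M φ P ≤ ENNReal.ofReal K →
      c ≤ ∫⁻ x, (φ x).exp := by
  refine ⟨((M - (K + 1) / η : ℝ) : EReal).exp * ENNReal.ofReal δ, ?_, fun φ hφ hle => ?_⟩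
  · rw [EReal.exp_coe]
    exact ENNReal.mul_pos (ENNReal.ofReal_pos.2 (Real.exp_pos _)).ne'
      (ENNReal.ofReal_pos.2 hδ).ne'
  · refine le_trans ?_ (exp_mul_measure_le_lintegral hφ.measurable
      ((M - (K + 1) / η : ℝ) : EReal))
    gcongr
    by_contra! hv
    have h1 := (hφ.ofReal_le_lintegral_deficit h (by positivity) hv.le).trans
      (le_self_add.trans hle)
    rw [div_mul_cancel₀ _ hη.ne', ENNReal.ofReal_le_ofReal_iff hK] at h1
    linarith

theorem MemPhi.mul_measure_le_measure [FiniteDimensional ℝ E]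
    [(volume : Measure E).IsAddHaarMeasure] {φ : E → EReal} (hφ : MemPhi φ) {x₀ : E} {m s : ℝ}
    (hx₀ : φ x₀ = m) (hs : 1 ≤ s) :
    ENNReal.ofReal (s⁻¹ ^ Module.finrank ℝ E) * volume {x | ((m - s : ℝ) : EReal) ≤ φ x}
      ≤ volume {x | ((m - 1 : ℝ) : EReal) ≤ φ x} := by
  have hs0 : 0 < s := one_pos.trans_le hs
  have h1 := Measure.addHaar_image_homothety (volume : Measure E) x₀ s⁻¹
    {x | ((m - s : ℝ) : EReal) ≤ φ x}
  rw [abs_of_nonneg (by positivity)] at h1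
  rw [← h1]
  refine measure_mono ?_
  rintro _ ⟨y, hy, rfl⟩
  rw [mem_ofPred_eq] at hy ⊢
  have hc := hφ.2.2.1 x₀ y s⁻¹ ⟨by positivity, inv_le_one_of_one_le₀ hs⟩
  have heq : AffineMap.homothety x₀ s⁻¹ y = (1 - s⁻¹) • x₀ + s⁻¹ • y := by
    rw [AffineMap.homothety_apply, vsub_eq_sub, vadd_eq_add]
    module
  rw [heq]
  refine le_trans ?_ hc
  have h0 : (0 : EReal) ≤ ((s⁻¹ : ℝ) : EReal) := EReal.coe_nonneg.2 (by positivity)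
  calc ((m - 1 : ℝ) : EReal)
      = ((1 - s⁻¹ : ℝ) : EReal) * (m : EReal) + ((s⁻¹ : ℝ) : EReal) * ((m - s : ℝ) : EReal) := by
        rw [← EReal.coe_mul, ← EReal.coe_mul, ← EReal.coe_add]
        congr 1
        field_simp
        ring
    _ ≤ _ := by
        rw [hx₀]
        gcongr

theorem exists_forall_ofReal_le_coLfun [FiniteDimensional ℝ E]
    [(volume : Measure E).IsAddHaarMeasure] (hδ : 0 < δ) (hη : 0 < η)
    (h : ∀ C : Set E, IsClosed C → Convex ℝ C → volume C ≤ ENNReal.ofReal δ →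
      ENNReal.ofReal η ≤ P Cᶜ) :
    ∃ M₀ : ℝ, ∀ m : ℝ, M₀ ≤ m → ∀ (φ : E → EReal) (x₀ : E), MemPhi φ → φ x₀ = m →
      ENNReal.ofReal (2 * m) ≤ coLfun m φ P := by
  set d := Module.finrank ℝ E
  have hev := (Real.tendsto_exp_div_pow_atTop (d + 1)).eventually_ge_atTop
    (2 * Real.exp 1 * (2 / η) ^ d / δ)
  obtain ⟨M₀, hM₀⟩ := eventually_atTop.1
    ((hev.and (eventually_ge_atTop (η / 2))).and (eventually_gt_atTop 0))
  refine ⟨M₀, fun m hm φ x₀ hφ hx₀ => ?_⟩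
  obtain ⟨⟨h1, h2⟩, h3⟩ := hM₀ m hm
  have hs : 1 ≤ 2 * m / η := by
    rw [le_div_iff₀ hη]
    linarith
  by_cases hv : volume {x | ((m - 2 * m / η : ℝ) : EReal) ≤ φ x} ≤ ENNReal.ofReal δ
  · have h4 := hφ.ofReal_le_lintegral_deficit h (by positivity) hv
    rw [div_mul_cancel₀ _ hη.ne'] at h4
    exact h4.trans le_self_add
  · have h4 : 2 * m ≤ Real.exp (m - 1) * ((2 * m / η)⁻¹ ^ d * δ) := by
      rw [le_div_iff₀ (by positivity), div_mul_eq_mul_div, div_le_iff₀ hδ] at h1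
      have h5 : Real.exp (m - 1) * ((2 * m / η)⁻¹ ^ d * δ)
          = Real.exp m * δ / (Real.exp 1 * (2 * m / η) ^ d) := by
        rw [Real.exp_sub, inv_pow]
        field_simp
      rw [h5, le_div_iff₀ (by positivity)]
      refine le_trans (le_of_eq ?_) h1
      rw [show 2 * m / η = 2 / η * m by ring, mul_pow, pow_succ]
      ring
    calc ENNReal.ofReal (2 * m)
        ≤ ENNReal.ofReal (Real.exp (m - 1) * ((2 * m / η)⁻¹ ^ d * δ)) :=
          ENNReal.ofReal_le_ofReal h4
      _ = ((m - 1 : ℝ) : EReal).exp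
            * (ENNReal.ofReal ((2 * m / η)⁻¹ ^ d) * ENNReal.ofReal δ) := by
          rw [EReal.exp_coe, ← ENNReal.ofReal_mul (by positivity),
            ← ENNReal.ofReal_mul (by positivity)]
      _ ≤ ((m - 1 : ℝ) : EReal).exp * volume {x | ((m - 1 : ℝ) : EReal) ≤ φ x} := by
          gcongr
          refine le_trans ?_ (hφ.mul_measure_le_measure hx₀ hs)
          gcongr
          exact (not_le.1 hv).le
      _ ≤ _ := exp_mul_measure_le_lintegral hφ.measurable _
      _ ≤ _ := le_add_self

theorem coLfun_neg_norm_ne_top [FiniteDimensional ℝ E]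
    [(volume : Measure E).IsAddHaarMeasure] (hP : Integrable (fun x => ‖x‖) P) :
    coLfun 0 (fun x : E => ((-‖x‖ : ℝ) : EReal)) P ≠ ∞ := by
  refine ENNReal.add_ne_top.2 ⟨?_, ?_⟩
  · simp only [deficit_coe, sub_neg_eq_add, zero_add]
    exact hP.lintegral_lt_top.ne
  · simp only [EReal.exp_coe]
    set d := Module.finrank ℝ E
    have hO : ∃ C : ℝ, 0 ≤ C ∧ ∀ r : ℝ, 0 ≤ r → Real.exp (-r) ≤ C * (1 + r) ^ (-(d + 1 : ℝ)) := by
      refine ⟨Real.exp 1 * (d + 1).factorial, by positivity, fun r hr => ?_⟩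
      have h1 := Real.pow_div_factorial_le_exp (1 + r) (by linarith) (d + 1)
      rw [Real.rpow_neg (by linarith), show (d + 1 : ℝ) = ((d + 1 : ℕ) : ℝ) by push_cast; rfl,
        Real.rpow_natCast, ← div_eq_mul_inv, le_div_iff₀ (by positivity), Real.exp_neg,
        inv_mul_le_iff₀ (Real.exp_pos r)]
      rw [div_le_iff₀ (by positivity), Real.exp_add] at h1
      linarith
    obtain ⟨C, hC, hle⟩ := hO
    have hi := (integrable_one_add_norm (E := E) (μ := volume) (r := d + 1)
      (by simp [d])).const_mul C
    exact (((lintegral_mono fun x => ENNReal.ofReal_le_ofReal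
      (hle ‖x‖ (norm_nonneg x)))).trans_lt hi.lintegral_lt_top).ne

end Coercivity

section Limits

theorem ENNReal.liminf_add_liminf_le (u v : ℕ → ℝ≥0∞) :
    liminf u atTop + liminf v atTop ≤ liminf (fun n => u n + v n) atTop := by
  have hmono : ∀ w : ℕ → ℝ≥0∞, Monotone fun n => ⨅ i ≥ n, w i := fun w a b hab =>
    le_iInf₂ fun i hi => iInf₂_le i (hab.trans hi)
  rw [liminf_eq_iSup_iInf_of_nat, liminf_eq_iSup_iInf_of_nat, liminf_eq_iSup_iInf_of_nat,
    ENNReal.iSup_add_iSup_of_monotone (hmono u) (hmono v)]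
  exact iSup_mono fun n => le_iInf₂ fun i hi => add_le_add (iInf₂_le i hi) (iInf₂_le i hi)

theorem tendsto_sqrtExp {ι : Type*} {l : Filter ι} {u : ι → EReal} {a : EReal} (ha : a ≠ ⊤)
    (hu : Tendsto u l (𝓝 a)) : Tendsto (fun i => sqrtExp (u i)) l (𝓝 (sqrtExp a)) :=
  (((ENNReal.tendsto_toReal (by simpa using ha)).comp
    ((ENNReal.continuous_exp.tendsto a).comp hu)).sqrt)

variable {α : Type*} [MeasurableSpace α] {μ : Measure α} {φ : ℕ → α → EReal}

theorem ae_tendsto_of_cauchy_sqrtExp (hmeas : ∀ n, Measurable (φ n)) (htop : ∀ n x, φ n x ≠ ⊤)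
    (hC : ∀ N n m, N ≤ n → N ≤ m →
      ∫⁻ x, ‖sqrtExp (φ n x) - sqrtExp (φ m x)‖ₑ ^ 2 ∂μ ≤ 2 * 4⁻¹ ^ N) :
    ∀ᵐ x ∂μ, Tendsto (fun n => φ n x) atTop (𝓝 (limsup (fun n => φ n x) atTop)) := by
  have hB : ∑' N : ℕ, (2 * 2⁻¹ ^ N : ℝ≥0∞) ≠ ∞ := by
    rw [ENNReal.tsum_mul_left, ENNReal.tsum_geometric, ENNReal.one_sub_inv_two, inv_inv]
    exact ENNReal.mul_ne_top ENNReal.ofNat_ne_top ENNReal.ofNat_ne_top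
  have hae := Lp.ae_tendsto_of_cauchy_eLpNorm (μ := μ) (p := 2) (f := fun n x => sqrtExp (φ n x))
    (fun n => (measurable_sqrtExp.comp (hmeas n)).aestronglyMeasurable) (by norm_num) hB
    (fun N n m hn hm => by
      have h1 := eLpNorm_nnreal_pow_eq_lintegral (μ := μ) (p := 2)
        (f := (fun x => sqrtExp (φ n x)) - fun x => sqrtExp (φ m x)) two_ne_zero
      simp only [NNReal.coe_ofNat, ENNReal.rpow_ofNat, ENNReal.coe_ofNat, Pi.sub_apply] at h1
      refine lt_of_not_ge fun hge => (pow_le_pow_left' hge 2).not_gt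
        (h1.trans_lt ((hC N n m hn hm).trans_lt ?_))
      have h4 : (2⁻¹ : ℝ≥0∞) ^ 2 = 4⁻¹ := by
        rw [← ENNReal.inv_pow]
        norm_num
      rw [mul_pow, ← pow_mul, mul_comm N, pow_mul, h4]
      refine ENNReal.mul_lt_mul_left (pow_ne_zero _ ?_) (ENNReal.pow_ne_top ?_) ?_
      · simp
      · simp
      · norm_num)
  filter_upwards [hae] with x ⟨l, hl⟩
  have h1 : Tendsto (fun n => φ n x) atTop (𝓝 (ENNReal.log (ENNReal.ofReal (l ^ 2)))) := by
    have := (ENNReal.continuous_log.tendsto _).comp (ENNReal.tendsto_ofReal (hl.pow 2))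
    refine this.congr fun n => ?_
    exact log_ofReal_sqrtExp_sq (htop n x)
  rwa [h1.limsup_eq]

theorem not_ae_eq_bot_of_cauchy_sqrtExp (hmeas : ∀ n, Measurable (φ n))
    (htop : ∀ n x, φ n x ≠ ⊤)
    (hC : ∀ N n m, N ≤ n → N ≤ m →
      ∫⁻ x, ‖sqrtExp (φ n x) - sqrtExp (φ m x)‖ₑ ^ 2 ∂μ ≤ 2 * 4⁻¹ ^ N)
    {c : ℝ≥0∞} (hc : 0 < c) (hle : ∀ n, c ≤ ∫⁻ x, (φ n x).exp ∂μ) {f : α → EReal}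
    (hlim : ∀ᵐ x ∂μ, Tendsto (fun n => φ n x) atTop (𝓝 (f x))) :
    ¬ ∀ᵐ x ∂μ, f x = ⊥ := by
  intro hbot
  have key : ∀ N, c ≤ 2 * 4⁻¹ ^ N := fun N => by
    calc c ≤ ∫⁻ x, (φ N x).exp ∂μ := hle N
      _ = ∫⁻ x, liminf (fun m => ‖sqrtExp (φ N x) - sqrtExp (φ m x)‖ₑ ^ 2) atTop ∂μ := by
        refine lintegral_congr_ae ?_
        filter_upwards [hlim, hbot] with x hx hfx
        rw [hfx] at hx
        have := ENNReal.Tendsto.pow (n := 2) ((tendsto_const_nhds (x := sqrtExp (φ N x))).sub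
          (tendsto_sqrtExp bot_ne_top hx)).enorm
        rw [sqrtExp_bot, sub_zero, enorm_sqrtExp_sq (htop N x)] at this
        exact this.liminf_eq.symm
      _ ≤ liminf (fun m => ∫⁻ x, ‖sqrtExp (φ N x) - sqrtExp (φ m x)‖ₑ ^ 2 ∂μ) atTop :=
        lintegral_liminf_le fun m => ((measurable_sqrtExp.comp (hmeas N)).sub
          (measurable_sqrtExp.comp (hmeas m))).enorm.pow_const 2
      _ ≤ liminf (fun _ : ℕ => (2 * 4⁻¹ ^ N : ℝ≥0∞)) atTop := by
        refine liminf_le_liminf ?_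
        filter_upwards [eventually_ge_atTop N] with m hm using hC N N m le_rfl hm
      _ = _ := by simp
  have hlim0 : Tendsto (fun N : ℕ => (2 * 4⁻¹ ^ N : ℝ≥0∞)) atTop (𝓝 0) := by
    have := ENNReal.Tendsto.const_mul (a := 2) (ENNReal.tendsto_pow_atTop_nhds_zero_of_lt_one
      (show (4⁻¹ : ℝ≥0∞) < 1 by simp)) (.inr ENNReal.ofNat_ne_top)
    simpa using this
  exact hc.not_ge (ge_of_tendsto hlim0 (.of_forall key))

end Limits

section Minimiser

variable {E : Type*} [NormedAddCommGroup E] [NormedSpace ℝ E] [FiniteDimensional ℝ E]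
  [MeasureSpace E] [BorelSpace E] [(volume : Measure E).IsAddHaarMeasure]
  {P : Measure E} {M : ℝ}

/-- Lower semicontinuity of `coLfun` along almost everywhere convergent sequences in `Φ`. -/
theorem MemPhi.exists_coLfun_le_liminf {φ : ℕ → E → EReal} (hφ : ∀ n, MemPhi (φ n))
    {f : E → EReal} (hf : ∀ x, f x ≤ M)
    (hlim : ∀ᵐ x, Tendsto (fun n => φ n x) atTop (𝓝 (f x))) (hpos : ¬ ∀ᵐ x, f x = ⊥)
    (hfin : liminf (fun n => coLfun M (φ n) P) atTop ≠ ∞) :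
    ∃ φs : E → EReal, MemPhi φs ∧ (∀ x, φs x ≤ M) ∧
      coLfun M φs P ≤ liminf (fun n => coLfun M (φ n) P) atTop := by
  have hφc := fun n => (hφ n).econcave
  set φs := essUscReg volume f
  have husc : UpperSemicontinuous φs := upperSemicontinuous_essUscReg f
  have hs : ∀ x, φs x ≤ M := essUscReg_le_of_forall_le hf
  have htop : ∀ x, φs x ≠ ⊤ := fun x => ((hs x).trans_lt (EReal.coe_lt_top M)).ne
  have hconc : EConcave φs := econcave_essUscReg hφc hlim
  have hdef : ∫⁻ x, deficit M (φs x) ∂P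
      ≤ liminf (fun n => ∫⁻ x, deficit M (φ n x) ∂P) atTop := by
    refine le_trans (lintegral_mono fun x => ?_) (lintegral_liminf_le fun n =>
      (measurable_deficit M).comp (hφ n).measurable)
    refine (antitone_deficit M (limsup_le_essUscReg hφc hlim hpos x)).trans_eq ?_
    exact (antitone_deficit M).map_limsup_of_continuousAt _ (continuous_deficit M).continuousAt
  have hexp : ∫⁻ x, (φs x).exp ≤ liminf (fun n => ∫⁻ x, (φ n x).exp) atTop := by
    refine le_trans (lintegral_mono_ae ?_) (lintegral_liminf_le fun n =>
      (hφ n).measurable.ereal_exp)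
    filter_upwards [hlim, essUscReg_le_ae hφc hlim] with x hx hle
    exact (EReal.exp_monotone hle).trans_eq
      ((ENNReal.continuous_exp.tendsto _).comp hx).liminf_eq.symm
  have hle : coLfun M φs P ≤ liminf (fun n => coLfun M (φ n) P) atTop :=
    (add_le_add hdef hexp).trans (ENNReal.liminf_add_liminf_le _ _)
  have hpos' : ¬ ∀ᵐ x, φs x = ⊥ := fun h => hpos <| by
    filter_upwards [h, hlim] with x hx hx'
    rw [← hx'.limsup_eq]
    exact le_bot_iff.1 ((limsup_le_essUscReg hφc hlim hpos x).trans_eq hx)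
  exact ⟨φs, ⟨htop, husc, fun x y t ht => hconc.add_le htop x y ht,
    hconc.tendsto_bot husc.measurable hpos'
      (ne_top_of_le_ne_top hfin (le_add_self.trans hle))⟩, hs, hle⟩

theorem exists_forall_coLfun_le {δ η : ℝ} (hδ : 0 < δ) (hη : 0 < η)
    (h : ∀ C : Set E, IsClosed C → Convex ℝ C → volume C ≤ ENNReal.ofReal δ →
      ENNReal.ofReal η ≤ P Cᶜ)
    (hfin : ∃ φ : E → EReal, MemPhi φ ∧ (∀ x, φ x ≤ M) ∧ coLfun M φ P ≠ ∞) :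
    ∃ φs : E → EReal, MemPhi φs ∧ (∀ x, φs x ≤ M) ∧
      ∀ φ : E → EReal, MemPhi φ → (∀ x, φ x ≤ M) → coLfun M φs P ≤ coLfun M φ P := by
  set j : ℝ≥0∞ := ⨅ (φ : E → EReal) (_ : MemPhi φ ∧ ∀ x, φ x ≤ M), coLfun M φ P
  have hj_le : ∀ φ : E → EReal, MemPhi φ → (∀ x, φ x ≤ M) → j ≤ coLfun M φ P :=
    fun φ h1 h2 => iInf₂_le φ ⟨h1, h2⟩
  have hj : j ≠ ∞ := by
    obtain ⟨φ, h1, h2, h3⟩ := hfin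
    exact ne_top_of_le_ne_top h3 (hj_le φ h1 h2)
  have h4 : (4⁻¹ : ℝ≥0∞) < 1 := by simp
  have hex : ∀ n : ℕ, ∃ φ : E → EReal, MemPhi φ ∧ (∀ x, φ x ≤ M) ∧
      coLfun M φ P ≤ j + 4⁻¹ ^ n := fun n => by
    have hlt : j < j + 4⁻¹ ^ n := ENNReal.lt_add_right hj (by simp)
    obtain ⟨φ, ⟨h1, h2⟩, h3⟩ := by simpa only [j, iInf_lt_iff, exists_prop] using hlt
    exact ⟨φ, h1, h2, h3.le⟩
  choose φ hφ hM hle using hex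
  have htop : ∀ n x, φ n x ≠ ⊤ := fun n => (hφ n).1
  have hmeas : ∀ n, Measurable (φ n) := fun n => (hφ n).measurable
  have hC : ∀ N n m, N ≤ n → N ≤ m →
      ∫⁻ x, ‖sqrtExp (φ n x) - sqrtExp (φ m x)‖ₑ ^ 2 ≤ 2 * 4⁻¹ ^ N := fun N n m hn hm => by
    have h1 := coLfun_emid_add (P := P) (hmeas n) (hmeas m) (hM n) (hM m)
    have h2 := hj_le _ ((hφ n).emid (hφ m))
      fun x => emid_le (hM n x) (hM m x) (EReal.coe_ne_top M)
    have hle' : ∀ k, N ≤ k → coLfun M (φ k) P ≤ j + 4⁻¹ ^ N := fun k hk =>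
      (hle k).trans (add_le_add le_rfl (pow_le_pow_right_of_le_one' h4.le hk))
    generalize ∫⁻ x, ‖sqrtExp (φ n x) - sqrtExp (φ m x)‖ₑ ^ 2 = I at *
    have h3 : j + 2⁻¹ * I ≤ j + 4⁻¹ ^ N := by
      calc j + 2⁻¹ * I ≤ _ := by gcongr
        _ = _ := h1
        _ ≤ 2⁻¹ * (j + 4⁻¹ ^ N) + 2⁻¹ * (j + 4⁻¹ ^ N) := by
          gcongr
          exacts [hle' n hn, hle' m hm]
        _ = j + 4⁻¹ ^ N := by rw [← add_mul, ENNReal.inv_two_add_inv_two, one_mul]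
    rw [ENNReal.add_le_add_iff_left hj] at h3
    calc I = 2 * (2⁻¹ * I) := by
          rw [← mul_assoc, ENNReal.mul_inv_cancel two_ne_zero ENNReal.ofNat_ne_top, one_mul]
      _ ≤ _ := by gcongr
  have hlim := ae_tendsto_of_cauchy_sqrtExp hmeas htop hC
  have hto : Tendsto (fun n : ℕ => j + 4⁻¹ ^ n) atTop (𝓝 j) := by
    simpa using tendsto_const_nhds.add (ENNReal.tendsto_pow_atTop_nhds_zero_of_lt_one h4)
  have hlimj : liminf (fun n => coLfun M (φ n) P) atTop = j :=
    (tendsto_of_tendsto_of_tendsto_of_le_of_le tendsto_const_nhds hto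
      (fun n => hj_le _ (hφ n) (hM n)) hle).liminf_eq
  obtain ⟨c, hc, hcle⟩ := exists_forall_le_lintegral_exp hδ hη h M
    (K := (j + 1).toReal) ENNReal.toReal_nonneg
  have hpos := not_ae_eq_bot_of_cauchy_sqrtExp hmeas htop hC hc (fun n => hcle _ (hφ n) (by
    rw [ENNReal.ofReal_toReal (by simpa using hj)]
    refine (hle n).trans ?_
    gcongr
    exact pow_le_one' h4.le n)) hlim
  obtain ⟨φs, h1, h2, h3⟩ := MemPhi.exists_coLfun_le_liminf hφ
    (fun x => limsup_le_of_le (h := .of_forall fun n => hM n x)) hlim hpos (hlimj.trans_ne hj)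
  exact ⟨φs, h1, h2, fun φ h4 h5 => (h3.trans_eq hlimj).trans (hj_le φ h4 h5)⟩

end Minimiser

section Support

theorem isClosed_csupp {E : Type*} [TopologicalSpace E] [AddCommGroup E] [Module ℝ E]
    [MeasurableSpace E] (P : Measure E) : IsClosed (csupp P) :=
  isClosed_sInter fun _ hC => hC.1

theorem convex_csupp {E : Type*} [TopologicalSpace E] [AddCommGroup E] [Module ℝ E]
    [MeasurableSpace E] (P : Measure E) : Convex ℝ (csupp P) :=
  convex_sInter fun _ hC => hC.2.1

theorem ae_mem_csupp {E : Type*} [TopologicalSpace E] [SecondCountableTopology E] [AddCommGroup E]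
    [Module ℝ E] [MeasurableSpace E] [OpensMeasurableSpace E] (P : Measure E)
    [IsProbabilityMeasure P] : ∀ᵐ x ∂P, x ∈ csupp P := by
  change P (csupp P)ᶜ = 0
  refine measure_null_of_locally_null _ fun x hx => ?_
  obtain ⟨C, hC, hxC⟩ : ∃ C, (IsClosed C ∧ Convex ℝ C ∧ P C = 1) ∧ x ∉ C := by
    simpa [csupp, and_assoc] using hx
  exact ⟨Cᶜ, mem_nhdsWithin_of_mem_nhds (hC.1.isOpen_compl.mem_nhds hxC),
    (prob_compl_eq_zero_iff hC.1.measurableSet).2 hC.2.2⟩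

open Classical in
theorem MemPhi.restrict {E : Type*} [NormedAddCommGroup E] [NormedSpace ℝ E] {φ : E → EReal}
    (hφ : MemPhi φ) {C : Set E} (hC : IsClosed C) (hconv : Convex ℝ C) :
    MemPhi fun x => if x ∈ C then φ x else ⊥ := by
  have hle : ∀ x, (if x ∈ C then φ x else ⊥) ≤ φ x := fun x => by
    split_ifs
    exacts [le_rfl, bot_le]
  have htop : ∀ x, (if x ∈ C then φ x else ⊥) ≠ ⊤ := fun x =>
    ((hle x).trans_lt (lt_top_iff_ne_top.2 (hφ.1 x))).ne
  refine ⟨htop, fun x y hxy => ?_, fun x y t ht => ?_,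
    tendsto_of_tendsto_of_tendsto_of_le_of_le tendsto_const_nhds hφ.2.2.2 (fun _ => bot_le) hle⟩
  · beta_reduce at hxy ⊢
    by_cases hx : x ∈ C
    · rw [if_pos hx] at hxy
      exact (hφ.2.1 x y hxy).mono fun z hz => (hle z).trans_lt hz
    · filter_upwards [hC.isOpen_compl.mem_nhds hx] with z hz
      rw [if_neg hz]
      exact bot_le.trans_lt hxy
  · refine EConcave.add_le (φ := fun x => if x ∈ C then φ x else ⊥) ?_ htop x y ht
    intro x y t ht a b ha hb
    have hx : x ∈ C := by
      by_contra hx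
      simp [hx] at ha
    have hy : y ∈ C := by
      by_contra hy
      simp [hy] at hb
    simp only [hx, hy, if_true] at ha hb ⊢
    rw [if_pos (hconv hx hy (sub_nonneg.2 ht.2.le) ht.1.le (sub_add_cancel _ _))]
    exact hφ.econcave x y t ht a b ha hb

end Support

section Maximiser

theorem Lfun_le_Lfun_iff {E : Type*} [NormedAddCommGroup E] [NormedSpace ℝ E] [MeasureSpace E]
    {P : Measure E} [IsProbabilityMeasure P] {M : ℝ} (hM : 0 ≤ M) {φ ψ : E → EReal}
    (hφm : Measurable φ) (hψm : Measurable ψ) (hφ : ∀ x, φ x ≤ M) (hψ : ∀ x, ψ x ≤ M) :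
    Lfun φ P ≤ Lfun ψ P ↔ coLfun M ψ P ≤ coLfun M φ P := by
  rw [Lfun_eq hM hφm hφ, Lfun_eq hM hψm hψ, ← EReal.coe_ennreal_le_coe_ennreal_iff]
  refine ⟨fun h => ?_, fun h => EReal.sub_le_sub le_rfl h⟩
  contrapose! h
  exact EReal.sub_lt_sub_of_le_of_gt le_rfl h (by simp) (by simp)

variable {E : Type*} [NormedAddCommGroup E] [NormedSpace ℝ E] [FiniteDimensional ℝ E]
  [MeasureSpace E] [BorelSpace E] {P : Measure E}

theorem MemPhi.interior_csupp_subset [IsProbabilityMeasure P] {φ : E → EReal} (hφ : MemPhi φ)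
    (hbot : Lfun φ P ≠ ⊥) : interior (csupp P) ⊆ {x | φ x ≠ ⊥} := by
  obtain ⟨M₁, hM₁⟩ := hφ.exists_real_ge
  have hM : 0 ≤ max 0 M₁ := le_max_left _ _
  have hφM : ∀ x, φ x ≤ (max 0 M₁ : ℝ) := fun x =>
    (hM₁ x).trans (EReal.coe_le_coe_iff.2 (le_max_right _ _))
  have hfin : ∫⁻ x, deficit (max 0 M₁) (φ x) ∂P ≠ ∞ := fun htop => hbot <| by
    rw [Lfun_eq hM hφ.measurable hφM, coLfun, htop, top_add, EReal.coe_ennreal_top, EReal.sub_top]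
  have hae : ∀ᵐ x ∂P, x ∈ {x | φ x ≠ ⊥} := by
    filter_upwards [ae_lt_top ((measurable_deficit _).comp hφ.measurable) hfin] with x hx hb
    simp [hb] at hx
  have hconv : Convex ℝ {x | φ x ≠ ⊥} := by
    simpa only [bot_lt_iff_ne_bot] using hφ.econcave.convex_lt ⊥
  have hsub : csupp P ⊆ closure {x | φ x ≠ ⊥} := by
    refine sInter_subset_of_mem ?_
    rw [mem_ofPred_eq]
    refine ⟨isClosed_closure, hconv.closure, ?_⟩
    exact (mem_ae_iff_prob_eq_one isClosed_closure.measurableSet).1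
      (hae.mono fun x hx => subset_closure hx)
  exact (interior_mono hsub).trans hconv.interior_closure_subset

variable [(volume : Measure E).IsAddHaarMeasure]

theorem MemPhi.essUscReg_eq {φ : E → EReal} (hφ : MemPhi φ)
    (hpos : ¬ ∀ᵐ x, φ x = ⊥) : essUscReg volume φ = φ := by
  funext x
  refine le_antisymm (essUscReg_le_of_upperSemicontinuous hφ.2.1 x) ?_
  simpa using limsup_le_essUscReg (φ := fun _ => φ) (fun _ => hφ.econcave)
    (.of_forall fun _ => tendsto_const_nhds) hpos x

theorem MemP.exists_forall_Lfun_le (hP : MemP P) :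
    ∃ φs : E → EReal, MemPhi φs ∧ (∀ φ : E → EReal, MemPhi φ → Lfun φ P ≤ Lfun φs P) ∧
      Lfun φs P ≠ ⊥ ∧ Lfun φs P ≠ ⊤ := by
  have := hP.1
  obtain ⟨δ, hδ, η, hη, h⟩ := hP.exists_measure_convex_le
  obtain ⟨M₀, hM₀⟩ := exists_forall_ofReal_le_coLfun hδ hη h
  set ψ : E → EReal := fun x => ((-‖x‖ : ℝ) : EReal)
  have hψ : MemPhi ψ := memPhi_neg_norm
  have hψ0 : ∀ x, ψ x ≤ (0 : ℝ) := fun x =>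
    EReal.coe_le_coe_iff.2 (neg_nonpos.2 (norm_nonneg x))
  have hψL := Lfun_eq (P := P) le_rfl hψ.measurable hψ0
  have hψfin : coLfun 0 ψ P ≠ ∞ := coLfun_neg_norm_ne_top hP.2.1
  obtain ⟨k, hk⟩ : ∃ k : NNReal, coLfun 0 ψ P = k := ⟨_, (ENNReal.coe_toNNReal hψfin).symm⟩
  have hψk : Lfun ψ P = ((-(k : ℝ) : ℝ) : EReal) := by
    rw [hψL, hk, EReal.coe_neg, EReal.coe_zero, zero_sub]
    rfl
  set M := max M₀ k
  have hM : 0 ≤ M := k.2.trans (le_max_right _ _)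
  have hψM : ∀ x, ψ x ≤ M := fun x => (hψ0 x).trans (EReal.coe_le_coe_iff.2 hM)
  have hψMfin : coLfun M ψ P ≠ ∞ := fun htop => by
    have := Lfun_eq (P := P) hM hψ.measurable hψM
    rw [htop, hψk, EReal.coe_ennreal_top, EReal.sub_top] at this
    exact EReal.coe_ne_bot _ this
  obtain ⟨φs, hφs, hφsM, hmin⟩ := exists_forall_coLfun_le hδ hη h ⟨ψ, hψ, hψM, hψMfin⟩
  have hmax : ∀ φ : E → EReal, MemPhi φ → (∀ x, φ x ≤ M) → Lfun φ P ≤ Lfun φs P :=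
    fun φ hφ hφM =>
      (Lfun_le_Lfun_iff hM hφ.measurable hφs.measurable hφM hφsM).2 (hmin φ hφ hφM)
  have hψs := hmax ψ hψ hψM
  refine ⟨φs, hφs, fun φ hφ => ?_, ?_, ?_⟩
  · by_cases hφM : ∀ x, φ x ≤ M
    · exact hmax φ hφ hφM
    obtain ⟨x₀, hx₀⟩ := hφ.exists_forall_le
    have hlt : (M : EReal) < φ x₀ := by
      push Not at hφM
      obtain ⟨y, hy⟩ := hφM
      exact hy.trans_le (hx₀ y)
    obtain ⟨m, hm⟩ : ∃ m : ℝ, φ x₀ = m :=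
      ⟨_, (EReal.coe_toReal (hφ.1 x₀) ((EReal.bot_lt_coe M).trans hlt).ne').symm⟩
    simp only [hm] at hx₀
    rw [hm, EReal.coe_lt_coe_iff] at hlt
    have hm0 : 0 ≤ m := hM.trans hlt.le
    refine le_trans ?_ hψs
    rw [Lfun_eq hm0 hφ.measurable hx₀, hψk]
    have h2 := hM₀ m ((le_max_left _ _).trans hlt.le) φ x₀ hφ hm
    calc (m : EReal) - (coLfun m φ P : EReal)
        ≤ (m : EReal) - ((ENNReal.ofReal (2 * m) : ℝ≥0∞) : EReal) :=
          EReal.sub_le_sub le_rfl (EReal.coe_ennreal_le_coe_ennreal_iff.2 h2)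
      _ = ((m - 2 * m : ℝ) : EReal) := by
          rw [EReal.coe_ennreal_ofReal, max_eq_left (by positivity), ← EReal.coe_sub]
      _ ≤ _ := EReal.coe_le_coe_iff.2 (by linarith [(le_max_right M₀ k).trans hlt.le])
  · rw [hψk] at hψs
    exact ((EReal.bot_lt_coe _).trans_le hψs).ne'
  · rw [Lfun_eq hM hφs.measurable hφsM]
    refine ((EReal.sub_le_sub le_rfl (EReal.coe_ennreal_nonneg _)).trans_lt ?_).ne
    rw [sub_zero]
    exact EReal.coe_lt_top M

theorem MemP.eq_of_forall_Lfun_le (hP : MemP P) {φ ψ : E → EReal} (hφ : MemPhi φ)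
    (hψ : MemPhi ψ) (hmax : ∀ χ : E → EReal, MemPhi χ → Lfun χ P ≤ Lfun φ P)
    (hle : Lfun φ P ≤ Lfun ψ P) (hbot : Lfun φ P ≠ ⊥) : φ = ψ := by
  have := hP.1
  obtain ⟨δ, hδ, η, hη, h⟩ := hP.exists_measure_convex_le
  obtain ⟨M₁, hM₁⟩ := hφ.exists_real_ge
  obtain ⟨M₂, hM₂⟩ := hψ.exists_real_ge
  set M := max 0 (max M₁ M₂)
  have hM : 0 ≤ M := le_max_left _ _
  have hφM : ∀ x, φ x ≤ M := fun x => (hM₁ x).trans (EReal.coe_le_coe_iff.2 (by simp [M]))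
  have hψM : ∀ x, ψ x ≤ M := fun x => (hM₂ x).trans (EReal.coe_le_coe_iff.2 (by simp [M]))
  have hfin : coLfun M φ P ≠ ∞ := fun htop => hbot <| by
    rw [Lfun_eq hM hφ.measurable hφM, htop, EReal.coe_ennreal_top, EReal.sub_top]
  have hψle := (Lfun_le_Lfun_iff hM hφ.measurable hψ.measurable hφM hψM).1 hle
  have hmid := (Lfun_le_Lfun_iff hM (hφ.emid hψ).measurable hφ.measurable
    (fun x => emid_le (hφM x) (hψM x) (EReal.coe_ne_top M)) hφM).1 (hmax _ (hφ.emid hψ))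
  have hpar := coLfun_emid_add (P := P) hφ.measurable hψ.measurable hφM hψM
  have hI : ∫⁻ x, ‖sqrtExp (φ x) - sqrtExp (ψ x)‖ₑ ^ 2 = 0 := by
    generalize ∫⁻ x, ‖sqrtExp (φ x) - sqrtExp (ψ x)‖ₑ ^ 2 = I at *
    have h3 : coLfun M φ P + 2⁻¹ * I ≤ coLfun M φ P + 0 := by
      calc coLfun M φ P + 2⁻¹ * I ≤ _ := by gcongr
        _ = _ := hpar
        _ ≤ 2⁻¹ * coLfun M φ P + 2⁻¹ * coLfun M φ P := by gcongr
        _ = _ := by rw [← add_mul, ENNReal.inv_two_add_inv_two, one_mul, add_zero]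
    rw [ENNReal.add_le_add_iff_left hfin] at h3
    simpa using h3
  have hmeas : Measurable fun x => ‖sqrtExp (φ x) - sqrtExp (ψ x)‖ₑ ^ 2 :=
    ((measurable_sqrtExp.comp hφ.measurable).sub
      (measurable_sqrtExp.comp hψ.measurable)).enorm.pow_const 2
  have hae : φ =ᵐ[volume] ψ := by
    filter_upwards [(lintegral_eq_zero_iff hmeas).1 hI] with x hx
    have : sqrtExp (φ x) = sqrtExp (ψ x) := by simpa [sub_eq_zero] using hx
    rw [← log_ofReal_sqrtExp_sq (hφ.1 x), this, log_ofReal_sqrtExp_sq (hψ.1 x)]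
  obtain ⟨c, hc, hcle⟩ := exists_forall_le_lintegral_exp hδ hη h M
    (K := (coLfun M φ P).toReal) ENNReal.toReal_nonneg
  have hpos : ¬ ∀ᵐ x, φ x = ⊥ := fun hb => by
    have h0 : ∫⁻ x, (φ x).exp = 0 := by
      rw [lintegral_eq_zero_iff hφ.measurable.ereal_exp]
      filter_upwards [hb] with x hx
      simp [hx]
    exact hc.not_ge (h0 ▸ hcle φ hφ (ENNReal.ofReal_toReal hfin).ge)
  have hpos' : ¬ ∀ᵐ x, ψ x = ⊥ := fun hb => hpos <| by
    filter_upwards [hb, hae] with x hx hx'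
    rw [hx', hx]
  rw [← hφ.essUscReg_eq hpos, essUscReg_congr hae, hψ.essUscReg_eq hpos']

open Classical in
theorem MemP.subset_csupp (hP : MemP P) {φ : E → EReal} (hφ : MemPhi φ)
    (hmax : ∀ χ : E → EReal, MemPhi χ → Lfun χ P ≤ Lfun φ P) (hbot : Lfun φ P ≠ ⊥) :
    {x | φ x ≠ ⊥} ⊆ csupp P := by
  have := hP.1
  obtain ⟨M₁, hM₁⟩ := hφ.exists_real_ge
  have hM : 0 ≤ max 0 M₁ := le_max_left _ _
  have hφM : ∀ x, φ x ≤ (max 0 M₁ : ℝ) := fun x =>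
    (hM₁ x).trans (EReal.coe_le_coe_iff.2 (le_max_right _ _))
  set ψ : E → EReal := fun x => if x ∈ csupp P then φ x else ⊥ with hψdef
  have hψ : MemPhi ψ := hφ.restrict (isClosed_csupp P) (convex_csupp P)
  have hle : ∀ x, ψ x ≤ φ x := fun x => by
    rw [hψdef]
    dsimp only
    split_ifs
    exacts [le_rfl, bot_le]
  have hL : Lfun φ P ≤ Lfun ψ P := by
    rw [Lfun_le_Lfun_iff hM hφ.measurable hψ.measurable hφM fun x => (hle x).trans (hφM x)]
    refine add_le_add (lintegral_mono_ae ?_) (lintegral_mono fun x => EReal.exp_monotone (hle x))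
    filter_upwards [ae_mem_csupp P] with x hx
    simp [hψdef, hx]
  have heq := hP.eq_of_forall_Lfun_le hφ hψ hmax hL hbot
  intro x hx
  rw [mem_ofPred_eq] at hx
  by_contra hxc
  refine hx ?_
  rw [heq, hψdef]
  simp [hxc]

end Maximiser

/-- For `P ∈ P_d`, the functional `L(·, P)` has a finite supremum over `Φ` and a unique
maximiser `φ*`, whose effective domain is sandwiched between the interior of the convex
support of `P` and the convex support itself. -/
theorem statement6 (d : ℕ) (P : Measure (Rd d)) (hP : MemP P) :
    (⊥ < Lstar P ∧ Lstar P < ⊤) ∧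
    ∃ φs : Rd d → EReal,
      (MemPhi φs ∧ ∀ φ : Rd d → EReal, MemPhi φ → Lfun φ P ≤ Lfun φs P) ∧
      (∀ φ : Rd d → EReal,
        (MemPhi φ ∧ ∀ ψ : Rd d → EReal, MemPhi ψ → Lfun ψ P ≤ Lfun φ P) → φ = φs) ∧
      interior (csupp P) ⊆ {x | φs x ≠ ⊥} ∧ {x | φs x ≠ ⊥} ⊆ csupp P := by
  obtain ⟨φs, hφs, hmax, hbot, htop⟩ := hP.exists_forall_Lfun_le
  have hstar : Lstar P = Lfun φs P := le_antisymm (iSup₂_le hmax) (le_iSup₂_of_le φs hφs le_rfl)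
  have := hP.1
  refine ⟨?_, φs, ⟨hφs, hmax⟩, fun φ hφ => ?_, hφs.interior_csupp_subset hbot,
    hP.subset_csupp hφs hmax hbot⟩
  · rw [hstar]
    exact ⟨bot_lt_iff_ne_bot.2 hbot, lt_top_iff_ne_top.2 htop⟩
  · exact (hP.eq_of_forall_Lfun_le hφs hφ.1 hmax (hφ.2 φs hφs) hbot).symm
end
end

section
/- Let P ∈ P_d and let P* be the measure with density ψ*(P) with respect to Lebesgue measure. Then ∫_{ℝ^d} h dP* ≤ ∫_{ℝ^d} h dP for every convex function h : ℝ^d → (−∞, ∞]. In particular, ∫_{ℝ^d} x dP*(x) = ∫_{ℝ^d} x dP(x), i.e., log-concave projection preserves the mean, and for μ denoting this common mean, the matrix ∫ (x−μ)(x−μ)ᵀ dP(x) − ∫ (x−μ)(x−μ)ᵀ dP*(x) is non-negative definite whenever P has finite second moment. -/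
open MeasureTheory Filter Set
open scoped ENNReal Topology

noncomputable section

/-- The measure with density `f` with respect to Lebesgue measure. -/
abbrev densityMeasure {E : Type*} [MeasureSpace E] (f : E → ℝ) : Measure E :=
  volume.withDensity fun x => ENNReal.ofReal (f x)

lemma IsDensity.isProbabilityMeasure {E : Type*} [MeasureSpace E] {f : E → ℝ}
    (hf : IsDensity f) : IsProbabilityMeasure (densityMeasure f) :=
  ⟨by rw [withDensity_apply _ MeasurableSet.univ, Measure.restrict_univ, hf.2.2]⟩

lemma IsLogConcaveFn.mul_exp_neg {E : Type*} [AddCommGroup E] [Module ℝ E] {f φ : E → ℝ}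
    (hf : IsLogConcaveFn f) (hφ : ConvexOn ℝ univ φ) :
    IsLogConcaveFn fun x => f x * Real.exp (-φ x) := by
  refine ⟨fun x => mul_nonneg (hf.1 x) (Real.exp_pos _).le, fun x y t ht => ?_⟩
  have hconv := hφ.2 (mem_univ x) (mem_univ y) (sub_nonneg.2 ht.2) ht.1 (by ring)
  simp only [smul_eq_mul] at hconv
  calc (f x * Real.exp (-φ x)) ^ (1 - t) * (f y * Real.exp (-φ y)) ^ t
      = (f x ^ (1 - t) * f y ^ t) * Real.exp (-((1 - t) * φ x + t * φ y)) := by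
        rw [Real.mul_rpow (hf.1 x) (Real.exp_pos _).le, Real.mul_rpow (hf.1 y) (Real.exp_pos _).le,
          ← Real.exp_mul, ← Real.exp_mul, mul_mul_mul_comm, ← Real.exp_add]
        congr 2
        ring
    _ ≤ _ := by
        refine mul_le_mul (hf.2 x y t ht) (Real.exp_le_exp.2 (neg_le_neg hconv))
          (Real.exp_pos _).le (hf.1 _)

lemma IsLogConcaveFn.div_const {E : Type*} [AddCommGroup E] [Module ℝ E] {f : E → ℝ}
    (hf : IsLogConcaveFn f) {c : ℝ} (hc : 0 < c) : IsLogConcaveFn fun x => f x / c := by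
  refine ⟨fun x => div_nonneg (hf.1 x) hc.le, fun x y t ht => ?_⟩
  rw [Real.div_rpow (hf.1 x) hc.le, Real.div_rpow (hf.1 y) hc.le, div_mul_div_comm,
    ← Real.rpow_add hc, sub_add_cancel, Real.rpow_one]
  exact div_le_div_of_nonneg_right (hf.2 x y t ht) hc.le

lemma UpperSemicontinuous.mul_continuous_of_nonneg {X : Type*} [TopologicalSpace X] {f c : X → ℝ}
    (hf : UpperSemicontinuous f) (hf0 : ∀ x, 0 ≤ f x) (hc : Continuous c) (hc0 : ∀ x, 0 < c x) :
    UpperSemicontinuous fun x => f x * c x := by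
  intro x y hy
  obtain ⟨z, hz, hzy⟩ := exists_between ((lt_div_iff₀ (hc0 x)).2 hy)
  have hz0 : 0 < z := (hf0 x).trans_lt hz
  filter_upwards [hf x z hz, (continuous_const.mul hc).continuousAt.eventually_lt
    continuousAt_const ((lt_div_iff₀ (hc0 x)).1 hzy)] with w hw hw'
  exact (mul_lt_mul_of_pos_right hw (hc0 w)).trans hw'

section Variational

variable {E : Type*} [NormedAddCommGroup E] [NormedSpace ℝ E] [MeasureSpace E] [BorelSpace E]
  {P : Measure E} [IsProbabilityMeasure P] {fs : E → ℝ}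

/-- Testing the maximiser against the exponentially tilted density `fs * exp (-φ)`. -/
lemma IsLCProj.exp_neg_integral_le (hfs : IsLCProj P fs) {φ : E → ℝ} (hφ : ConvexOn ℝ univ φ)
    (hφc : Continuous φ) (hφ0 : ∀ x, 0 ≤ φ x) (hφP : Integrable φ P) :
    Real.exp (-∫ x, φ x ∂P) ≤ ∫ x, Real.exp (-φ x) ∂(densityMeasure fs) := by
  obtain ⟨⟨⟨hf0, hfm, hf1⟩, hfu, hflc⟩, hpos, hlog, hmax⟩ := hfs
  have : IsProbabilityMeasure (densityMeasure fs) :=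
    IsDensity.isProbabilityMeasure ⟨hf0, hfm, hf1⟩
  have hem : Measurable fun x => Real.exp (-φ x) := (Real.continuous_exp.comp hφc.neg).measurable
  have hint : Integrable (fun x => Real.exp (-φ x)) (densityMeasure fs) :=
    (integrable_const (1 : ℝ)).mono' hem.aestronglyMeasurable
      (.of_forall fun x => by simpa [Real.abs_exp] using hφ0 x)
  set Z : ℝ := ∫ x, Real.exp (-φ x) ∂(densityMeasure fs) with hZ
  have hZpos : 0 < Z := integral_exp_pos hint
  have hZE : ∫⁻ x, ENNReal.ofReal (fs x * Real.exp (-φ x)) = ENNReal.ofReal Z := by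
    rw [hZ, ofReal_integral_eq_lintegral_ofReal hint (.of_forall fun x => (Real.exp_pos _).le),
      lintegral_withDensity_eq_lintegral_mul _ hfm.ennreal_ofReal hem.ennreal_ofReal]
    simp [ENNReal.ofReal_mul (hf0 _)]
  have hg : IsLCDensity fun x => fs x * Real.exp (-φ x) / Z := by
    refine ⟨⟨fun x => div_nonneg (mul_nonneg (hf0 x) (Real.exp_pos _).le) hZpos.le,
      (hfm.mul hem).div_const _, ?_⟩, ?_, (hflc.mul_exp_neg hφ).div_const hZpos⟩
    · simp_rw [ENNReal.ofReal_div_of_pos hZpos, ENNReal.div_eq_inv_mul]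
      rw [lintegral_const_mul' _ _ (by simpa using hZpos), hZE]
      exact ENNReal.inv_mul_cancel (by simpa using hZpos) ENNReal.ofReal_ne_top
    · simp_rw [mul_div_assoc]
      exact hfu.mul_continuous_of_nonneg hf0 ((Real.continuous_exp.comp hφc.neg).div_const Z)
        fun x => div_pos (Real.exp_pos _) hZpos
  have hglog : (fun x => Real.log (fs x * Real.exp (-φ x) / Z)) =ᵐ[P]
      fun x => Real.log (fs x) - φ x - Real.log Z := by
    filter_upwards [hpos] with x hx
    rw [Real.log_div (by positivity) hZpos.ne', Real.log_mul hx.ne' (Real.exp_pos _).ne',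
      Real.log_exp, sub_eq_add_neg (Real.log (fs x))]
  have hsub : Integrable (fun x => Real.log (fs x) - φ x) P := hlog.sub hφP
  have h1 := hmax _ hg
    (hpos.mono fun x hx => div_pos (mul_pos hx (Real.exp_pos _)) hZpos)
    ((hsub.sub (integrable_const _)).congr hglog.symm)
  rw [integral_congr_ae hglog, integral_sub hsub (integrable_const _),
    integral_sub hlog hφP, integral_const, probReal_univ, one_smul] at h1
  rw [← Real.le_log_iff_exp_le hZpos]
  linarith

lemma tendsto_one_sub_exp_neg_mul_nat (a : ℝ) :
    Tendsto (fun n : ℕ => ((n : ℝ) + 1) * (1 - Real.exp (-(((n : ℝ) + 1)⁻¹ * a)))) atTop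
      (𝓝 a) := by
  have h : HasDerivAt (fun t : ℝ => 1 - Real.exp (-(t * a))) a 0 := by
    have := (((hasDerivAt_id (0 : ℝ)).mul_const a).neg.exp).const_sub 1
    simpa using this
  have ht : Tendsto (fun n : ℕ => ((n : ℝ) + 1)⁻¹) atTop (𝓝[≠] 0) :=
    tendsto_nhdsWithin_iff.2 ⟨by simpa using tendsto_one_div_add_atTop_nhds_zero_nat (𝕜 := ℝ),
      .of_forall fun n => by simp only [mem_compl_iff, mem_singleton_iff]; positivity⟩
  refine ((hasDerivAt_iff_tendsto_slope.1 h).comp ht).congr fun n => ?_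
  simp [slope_def_field, div_eq_mul_inv, mul_comm]

theorem IsLCProj.lintegral_le (hfs : IsLCProj P fs) {φ : E → ℝ} (hφ : ConvexOn ℝ univ φ)
    (hφc : Continuous φ) (hφ0 : ∀ x, 0 ≤ φ x) (hφP : Integrable φ P) :
    ∫⁻ x, ENNReal.ofReal (φ x) ∂(densityMeasure fs) ≤ ENNReal.ofReal (∫ x, φ x ∂P) := by
  have := hfs.1.1.isProbabilityMeasure
  let u : ℕ → E → ℝ := fun n x => ((n : ℝ) + 1) * (1 - Real.exp (-(((n : ℝ) + 1)⁻¹ * φ x)))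
  have huc : ∀ n, Continuous (u n) := fun n => by fun_prop
  have hu : ∀ n, ∫⁻ x, ENNReal.ofReal (u n x) ∂(densityMeasure fs) ≤
      ENNReal.ofReal (∫ x, φ x ∂P) := by
    intro n
    have hn : (0 : ℝ) < (n : ℝ) + 1 := by positivity
    have hψ0 : ∀ x, 0 ≤ ((n : ℝ) + 1)⁻¹ * φ x := fun x => mul_nonneg (inv_pos.2 hn).le (hφ0 x)
    have hexp := hfs.exp_neg_integral_le (φ := fun x => ((n : ℝ) + 1)⁻¹ * φ x)
      (by simpa using hφ.smul (inv_pos.2 hn).le) (by fun_prop) hψ0 (hφP.const_mul _)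
    have hint : Integrable (fun x => Real.exp (-(((n : ℝ) + 1)⁻¹ * φ x))) (densityMeasure fs) :=
      (integrable_const (1 : ℝ)).mono'
        (Continuous.measurable (by fun_prop)).aestronglyMeasurable
        (.of_forall fun x => by simpa [Real.abs_exp] using hψ0 x)
    have hu0 : ∀ x, 0 ≤ u n x := fun x =>
      mul_nonneg hn.le (sub_nonneg.2 (Real.exp_le_one_iff.2 (neg_nonpos.2 (hψ0 x))))
    have hui : Integrable (u n) (densityMeasure fs) :=
      ((integrable_const (1 : ℝ)).sub hint).const_mul _
    rw [← ofReal_integral_eq_lintegral_ofReal hui (.of_forall hu0)]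
    refine ENNReal.ofReal_le_ofReal ?_
    have : ∫ x, u n x ∂(densityMeasure fs) = ((n : ℝ) + 1) *
        (1 - ∫ x, Real.exp (-(((n : ℝ) + 1)⁻¹ * φ x)) ∂(densityMeasure fs)) := by
      rw [integral_const_mul, integral_sub (integrable_const _) hint]
      simp
    rw [this]
    rw [integral_const_mul] at hexp
    have h2 := Real.add_one_le_exp (-(((n : ℝ) + 1)⁻¹ * ∫ x, φ x ∂P))
    rw [← le_div_iff₀' hn, div_eq_inv_mul]
    linarith
  calc ∫⁻ x, ENNReal.ofReal (φ x) ∂(densityMeasure fs)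
      = ∫⁻ x, liminf (fun n => ENNReal.ofReal (u n x)) atTop ∂(densityMeasure fs) := by
        refine lintegral_congr fun x => ?_
        exact ((ENNReal.continuous_ofReal.tendsto _).comp
          (tendsto_one_sub_exp_neg_mul_nat (φ x))).liminf_eq.symm
    _ ≤ liminf (fun n => ∫⁻ x, ENNReal.ofReal (u n x) ∂(densityMeasure fs)) atTop :=
        lintegral_liminf_le fun n => (huc n).measurable.ennreal_ofReal
    _ ≤ ENNReal.ofReal (∫ x, φ x ∂P) :=
        liminf_le_of_le (by isBoundedDefault) fun b hb => by
          obtain ⟨n, hn⟩ := hb.exists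
          exact hn.trans (hu n)

lemma IsLCProj.integrable_of_nonneg (hfs : IsLCProj P fs) {φ : E → ℝ} (hφ : ConvexOn ℝ univ φ)
    (hφc : Continuous φ) (hφ0 : ∀ x, 0 ≤ φ x) (hφP : Integrable φ P) :
    Integrable φ (densityMeasure fs) :=
  (lintegral_ofReal_ne_top_iff_integrable hφc.measurable.aestronglyMeasurable
    (.of_forall hφ0)).1 ((hfs.lintegral_le hφ hφc hφ0 hφP).trans_lt ENNReal.ofReal_lt_top).ne

lemma IsLCProj.integral_le_of_nonneg (hfs : IsLCProj P fs) {φ : E → ℝ} (hφ : ConvexOn ℝ univ φ)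
    (hφc : Continuous φ) (hφ0 : ∀ x, 0 ≤ φ x) (hφP : Integrable φ P) :
    ∫ x, φ x ∂(densityMeasure fs) ≤ ∫ x, φ x ∂P := by
  rw [← ENNReal.ofReal_le_ofReal_iff (integral_nonneg hφ0),
    ofReal_integral_eq_lintegral_ofReal (hfs.integrable_of_nonneg hφ hφc hφ0 hφP)
      (.of_forall hφ0)]
  exact hfs.lintegral_le hφ hφc hφ0 hφP

lemma IsLCProj.integral_le (hfs : IsLCProj P fs) {φ : E → ℝ} (hφ : ConvexOn ℝ univ φ)
    (hφc : Continuous φ) (hφP : Integrable φ P) (hφs : Integrable φ (densityMeasure fs)) :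
    ∫ x, φ x ∂(densityMeasure fs) ≤ ∫ x, φ x ∂P := by
  have := hfs.1.1.isProbabilityMeasure
  have key : ∀ n : ℕ, ∫ x, max (φ x) (-(n : ℝ)) ∂(densityMeasure fs) ≤
      ∫ x, max (φ x) (-(n : ℝ)) ∂P := by
    intro n
    have hP' : Integrable (fun x => max (φ x) (-(n : ℝ))) P := hφP.sup (integrable_const _)
    have hs' : Integrable (fun x => max (φ x) (-(n : ℝ))) (densityMeasure fs) :=
      hφs.sup (integrable_const _)
    have h := hfs.integral_le_of_nonneg (φ := fun x => max (φ x) (-(n : ℝ)) + n)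
      ((hφ.sup (convexOn_const _ convex_univ)).add (convexOn_const _ convex_univ)) (by fun_prop)
      (fun x => by linarith [le_max_right (φ x) (-(n : ℝ))]) (hP'.add (integrable_const _))
    rw [integral_add hP' (integrable_const _), integral_add hs' (integrable_const _)] at h
    simpa using h
  have lim : ∀ Q : Measure E, Integrable φ Q →
      Tendsto (fun n : ℕ => ∫ x, max (φ x) (-(n : ℝ)) ∂Q) atTop (𝓝 (∫ x, φ x ∂Q)) := by
    intro Q hQ
    refine tendsto_integral_of_dominated_convergence (fun x => |φ x|)
      (fun n => (hφc.max continuous_const).measurable.aestronglyMeasurable) hQ.abs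
      (fun n => .of_forall fun x => ?_) (.of_forall fun x => ?_)
    · rw [Real.norm_eq_abs, abs_le]
      refine ⟨(neg_abs_le _).trans (le_max_left _ _), max_le (le_abs_self _) ?_⟩
      exact (neg_nonpos.2 n.cast_nonneg).trans (abs_nonneg _)
    · obtain ⟨N, hN⟩ := exists_nat_ge (-φ x)
      refine tendsto_const_nhds.congr' ?_
      filter_upwards [eventually_ge_atTop N] with n hn
      have : (N : ℝ) ≤ n := by exact_mod_cast hn
      rw [max_eq_left (by linarith)]
  exact le_of_tendsto_of_tendsto' (lim _ hφs) (lim _ hφP) key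

end Variational

section Regularization

lemma ConvexOn.exists_sub_mul_norm_le_of_mem_interior {E : Type*} [NormedAddCommGroup E]
    [NormedSpace ℝ E] [FiniteDimensional ℝ E] {D : Set E} {k : E → ℝ} (hk : ConvexOn ℝ D k)
    {x : E} (hx : x ∈ interior D) :
    ∃ A : ℝ, 0 ≤ A ∧ ∀ y ∈ D, k x - A * ‖y - x‖ ≤ k y := by
  have hcont : ContinuousAt k x :=
    hk.continuousOn_interior.continuousAt (isOpen_interior.mem_nhds hx)
  obtain ⟨r, hr, hball⟩ := Metric.eventually_nhds_iff_ball.1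
    ((hcont.eventually_lt continuousAt_const (lt_add_one (k x))).and
      (mem_interior_iff_mem_nhds.1 hx))
  have hr2 : 0 < r / 2 := by positivity
  refine ⟨(r / 2)⁻¹, by positivity, fun y hy => ?_⟩
  rcases eq_or_ne y x with rfl | hne
  · simp
  set s : ℝ := ‖y - x‖ with hs
  have hs0 : 0 < s := norm_pos_iff.2 (sub_ne_zero.2 hne)
  set z : E := x - (r / 2 / s) • (y - x) with hz
  have hzball : z ∈ Metric.ball x r := by
    rw [mem_ball_iff_norm, hz, sub_sub_cancel_left, norm_neg, norm_smul, Real.norm_of_nonneg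
      (by positivity), ← hs, div_mul_cancel₀ _ hs0.ne']
    linarith
  obtain ⟨hkz, hzD⟩ : k z < k x + 1 ∧ z ∈ D := hball z hzball
  have hsum : r / 2 + s ≠ 0 := by positivity
  have hxz : (r / 2 / (r / 2 + s)) • y + (s / (r / 2 + s)) • z = x := by
    rw [hz]
    match_scalars <;> field_simp <;> ring
  have hconv := hk.2 hy hzD (show 0 ≤ r / 2 / (r / 2 + s) by positivity)
    (show 0 ≤ s / (r / 2 + s) by positivity) (by field_simp)
  rw [hxz, smul_eq_mul, smul_eq_mul, div_mul_eq_mul_div _ (r / 2 + s) (k y),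
    div_mul_eq_mul_div s, ← add_div, le_div_iff₀ (by positivity)] at hconv
  have h1 : s * k z ≤ s * (k x + 1) := mul_le_mul_of_nonneg_left hkz.le hs0.le
  have h2 : r / 2 * (k x - (r / 2)⁻¹ * s) = r / 2 * k x - s := by field_simp
  refine le_of_mul_le_mul_left ?_ hr2
  rw [h2]
  linarith

lemma ConvexOn.exists_linear_lower_bound {E : Type*} [NormedAddCommGroup E]
    [InnerProductSpace ℝ E] [FiniteDimensional ℝ E] {D : Set E} {k : E → ℝ}
    (hk : ConvexOn ℝ D k) (hD : D.Nonempty) :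
    ∃ A B : ℝ, 0 ≤ B ∧ ∀ y ∈ D, -(A + B * ‖y‖) ≤ k y := by
  obtain ⟨x₀, hx₀⟩ := hD
  let V := vectorSpan ℝ D
  let p : E →ᵃ[ℝ] E :=
    V.starProjection.toLinearMap.toAffineMap.comp
      (AffineMap.id ℝ E - AffineMap.const ℝ E x₀) + AffineMap.const ℝ E x₀
  have hp : ∀ x, p x = V.starProjection (x - x₀) + x₀ := fun x => rfl
  have hpD : ∀ y ∈ D, p y = y := fun y hy => by
    have : y - x₀ ∈ V := vsub_mem_vectorSpan ℝ hy hx₀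
    rw [hp, V.starProjection_eq_self_iff.2 this]
    simp
  have hcomp : ConvexOn ℝ (p ⁻¹' D) (k ∘ p) := hk.comp_affineMap p
  have hsub : D ⊆ p ⁻¹' D := fun y hy => by simpa [hpD y hy] using hy
  have hspan : affineSpan ℝ (p ⁻¹' D) = ⊤ := by
    have hx₀' : x₀ ∈ p ⁻¹' D := hsub hx₀
    rw [← AffineSubspace.direction_eq_top_iff_of_nonempty
      ((affineSpan_nonempty ℝ).2 ⟨x₀, hx₀'⟩), direction_affineSpan, eq_top_iff,
      ← V.sup_orthogonal_of_hasOrthogonalProjection]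
    refine sup_le (vectorSpan_mono ℝ hsub) fun w hw => ?_
    have hw' : w + x₀ ∈ p ⁻¹' D := by
      rw [mem_preimage, hp, add_sub_cancel_right,
        V.starProjection_apply_eq_zero_iff.2 hw, zero_add]
      exact hx₀
    simpa using vsub_mem_vectorSpan ℝ hw' hx₀'
  obtain ⟨z, hz⟩ := (hcomp.1.interior_nonempty_iff_affineSpan_eq_top).2 hspan
  obtain ⟨B, hB, h⟩ := hcomp.exists_sub_mul_norm_le_of_mem_interior hz
  refine ⟨B * ‖z‖ - k (p z), B, hB, fun y hy => ?_⟩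
  have h1 := h y (hsub hy)
  simp only [Function.comp, hpD y hy] at h1
  have h2 := mul_le_mul_of_nonneg_left (norm_sub_le y z) hB
  linarith

/-- The Pasch–Hausdorff regularisation of `k` (extended by `+∞` off `D`): the largest
`L`-Lipschitz function lying below `k` on `D`. -/
def lipschitzReg {E : Type*} [NormedAddCommGroup E] (D : Set E) (k : E → ℝ) (L : ℝ) (x : E) : ℝ :=
  ⨅ y : D, (k y + L * ‖x - y‖)

variable {E : Type*} [NormedAddCommGroup E] {D : Set E} {k : E → ℝ} {A B L : ℝ}

lemma neg_add_mul_norm_add_le (hB : ∀ y ∈ D, -(A + B * ‖y‖) ≤ k y) (hB0 : 0 ≤ B) (x : E)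
    {y : E} (hy : y ∈ D) : -(A + B * ‖x‖) + (L - B) * ‖x - y‖ ≤ k y + L * ‖x - y‖ := by
  have h1 := hB y hy
  have h2 : B * ‖y‖ ≤ B * (‖x‖ + ‖x - y‖) :=
    mul_le_mul_of_nonneg_left (by simpa [norm_sub_rev] using norm_le_norm_add_norm_sub' y x) hB0
  linarith

lemma neg_add_mul_norm_le (hB : ∀ y ∈ D, -(A + B * ‖y‖) ≤ k y) (hB0 : 0 ≤ B) (hL : B ≤ L)
    (x : E) {y : E} (hy : y ∈ D) : -(A + B * ‖x‖) ≤ k y + L * ‖x - y‖ := by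
  have h1 := neg_add_mul_norm_add_le (L := L) hB hB0 x hy
  have h2 := mul_nonneg (sub_nonneg.2 hL) (norm_nonneg (x - y))
  linarith

lemma bddBelow_lipschitzReg (hB : ∀ y ∈ D, -(A + B * ‖y‖) ≤ k y) (hB0 : 0 ≤ B) (hL : B ≤ L)
    (x : E) : BddBelow (range fun y : D => k y + L * ‖x - y‖) :=
  ⟨-(A + B * ‖x‖), by rintro _ ⟨y, rfl⟩; exact neg_add_mul_norm_le hB hB0 hL x y.2⟩

lemma lipschitzReg_le (hB : ∀ y ∈ D, -(A + B * ‖y‖) ≤ k y) (hB0 : 0 ≤ B) (hL : B ≤ L)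
    (x : E) {y : E} (hy : y ∈ D) : lipschitzReg D k L x ≤ k y + L * ‖x - y‖ :=
  ciInf_le (bddBelow_lipschitzReg hB hB0 hL x) ⟨y, hy⟩

lemma lipschitzReg_le_self (hB : ∀ y ∈ D, -(A + B * ‖y‖) ≤ k y) (hB0 : 0 ≤ B) (hL : B ≤ L)
    {y : E} (hy : y ∈ D) : lipschitzReg D k L y ≤ k y := by
  simpa using lipschitzReg_le hB hB0 hL y hy

lemma le_lipschitzReg (hD : D.Nonempty) {x : E} {c : ℝ} (h : ∀ y ∈ D, c ≤ k y + L * ‖x - y‖) :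
    c ≤ lipschitzReg D k L x :=
  have := hD.to_subtype
  le_ciInf fun y => h y y.2

lemma lipschitzReg_mono (hD : D.Nonempty) (hB : ∀ y ∈ D, -(A + B * ‖y‖) ≤ k y) (hB0 : 0 ≤ B)
    {M : ℝ} (hL : B ≤ L) (hLM : L ≤ M) (x : E) : lipschitzReg D k L x ≤ lipschitzReg D k M x :=
  le_lipschitzReg hD fun y hy => (lipschitzReg_le hB hB0 hL x hy).trans <| by gcongr

lemma lipschitzWith_lipschitzReg (hD : D.Nonempty) (hB : ∀ y ∈ D, -(A + B * ‖y‖) ≤ k y)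
    (hB0 : 0 ≤ B) (hL : B ≤ L) : LipschitzWith L.toNNReal (lipschitzReg D k L) := by
  have hL0 : 0 ≤ L := hB0.trans hL
  refine LipschitzWith.of_le_add_mul _ fun x x' => ?_
  rw [← sub_le_iff_le_add, Real.coe_toNNReal _ hL0]
  refine le_lipschitzReg hD fun y hy => ?_
  have h1 := lipschitzReg_le hB hB0 hL x hy
  have h2 : L * ‖x - y‖ ≤ L * (dist x x' + ‖x' - y‖) := by
    gcongr
    rw [dist_eq_norm]
    exact norm_sub_le_norm_sub_add_norm_sub x x' y
  linarith

lemma convexOn_lipschitzReg [NormedSpace ℝ E] (hk : ConvexOn ℝ D k) (hD : D.Nonempty)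
    (hB : ∀ y ∈ D, -(A + B * ‖y‖) ≤ k y) (hB0 : 0 ≤ B) (hL : B ≤ L) :
    ConvexOn ℝ univ (lipschitzReg D k L) := by
  have hL0 : 0 ≤ L := hB0.trans hL
  have := hD.to_subtype
  refine ⟨convex_univ, fun x _ x' _ a b ha hb hab => ?_⟩
  refine le_of_forall_pos_le_add fun ε hε => ?_
  obtain ⟨y, hy⟩ := exists_lt_of_ciInf_lt (lt_add_of_pos_right (lipschitzReg D k L x) hε)
  obtain ⟨y', hy'⟩ := exists_lt_of_ciInf_lt (lt_add_of_pos_right (lipschitzReg D k L x') hε)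
  have h1 := lipschitzReg_le hB hB0 hL (a • x + b • x') (hk.1 y.2 y'.2 ha hb hab)
  have h2 := hk.2 y.2 y'.2 ha hb hab
  have h3 : ‖a • x + b • x' - (a • (y : E) + b • (y' : E))‖ ≤ a * ‖x - y‖ + b * ‖x' - y'‖ := by
    rw [add_sub_add_comm, ← smul_sub, ← smul_sub]
    refine (norm_add_le _ _).trans_eq ?_
    rw [norm_smul_of_nonneg ha, norm_smul_of_nonneg hb]
  have h4 := mul_le_mul_of_nonneg_left h3 hL0
  have h5 := mul_le_mul_of_nonneg_left hy.le ha
  have h6 := mul_le_mul_of_nonneg_left hy'.le hb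
  simp only [smul_eq_mul] at h2 ⊢
  have h7 : ε = a * ε + b * ε := by rw [← add_mul, hab, one_mul]
  linarith

lemma eventually_lipschitzReg_eq [NormedSpace ℝ E] [FiniteDimensional ℝ E] (hk : ConvexOn ℝ D k)
    (hB : ∀ y ∈ D, -(A + B * ‖y‖) ≤ k y) (hB0 : 0 ≤ B) {x : E} (hx : x ∈ interior D) :
    ∀ᶠ L in atTop, lipschitzReg D k L x = k x := by
  obtain ⟨C, -, h⟩ := hk.exists_sub_mul_norm_le_of_mem_interior hx
  have hxD := interior_subset hx
  filter_upwards [eventually_ge_atTop B, eventually_ge_atTop C] with L hL hC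
  refine (lipschitzReg_le_self hB hB0 hL hxD).antisymm (le_lipschitzReg ⟨x, hxD⟩ fun y hy => ?_)
  have h1 := h y hy
  have h2 := mul_le_mul_of_nonneg_right hC (norm_nonneg (y - x))
  rw [norm_sub_rev x y]
  linarith

lemma tendsto_lipschitzReg_atTop (hD : D.Nonempty) (hB : ∀ y ∈ D, -(A + B * ‖y‖) ≤ k y)
    (hB0 : 0 ≤ B) {x : E} (hx : x ∉ closure D) :
    Tendsto (fun L => lipschitzReg D k L x) atTop atTop := by
  obtain ⟨δ, hδ, hball⟩ : ∃ δ > 0, ∀ y ∈ D, δ ≤ dist x y := by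
    simpa [Metric.mem_closure_iff] using hx
  refine tendsto_atTop_mono' atTop ((eventually_ge_atTop B).mono fun L hL => ?_)
    (tendsto_atTop_add_const_left _ (-(A + B * ‖x‖))
      ((tendsto_atTop_add_const_right _ (-B) tendsto_id).atTop_mul_const hδ))
  refine le_lipschitzReg hD fun y hy => ?_
  have h1 := neg_add_mul_norm_add_le (L := L) hB hB0 x hy
  have h2 := mul_le_mul_of_nonneg_left (hball y hy) (sub_nonneg.2 hL)
  rw [dist_eq_norm] at h2
  simp only [id]
  linarith

end Regularization

section ERealIntegral

@[simp]
lemma epos_coe (r : ℝ) : epos (r : EReal) = ENNReal.ofReal r := by simp [epos]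

lemma epos_mono : Monotone epos := by
  intro a b hab
  induction b with
  | top => simp [epos]
  | bot => simp [le_bot_iff.1 hab]
  | coe b =>
    induction a with
    | top => simp at hab
    | bot => simp [epos]
    | coe a => simpa using ENNReal.ofReal_le_ofReal (EReal.coe_le_coe_iff.1 hab)

lemma erealIntegral_mono {α : Type*} [MeasurableSpace α] (P : Measure α) {φ ψ : α → EReal}
    (h : ∀ x, φ x ≤ ψ x) : erealIntegral P φ ≤ erealIntegral P ψ :=
  EReal.sub_le_sub (EReal.coe_ennreal_le_coe_ennreal_iff.2 (lintegral_mono fun x => epos_mono (h x)))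
    (EReal.coe_ennreal_le_coe_ennreal_iff.2
      (lintegral_mono fun x => epos_mono (EReal.neg_le_neg_iff.2 (h x))))

lemma erealIntegral_coe {α : Type*} [MeasurableSpace α] {P : Measure α} {φ : α → ℝ}
    (hφ : Integrable φ P) :
    erealIntegral P (fun x => (φ x : EReal)) = ((∫ x, φ x ∂P : ℝ) : EReal) := by
  have h1 : ∫⁻ x, ENNReal.ofReal (φ x) ∂P ≠ ⊤ := hφ.lintegral_lt_top.ne
  have h2 : ∫⁻ x, ENNReal.ofReal (-φ x) ∂P ≠ ⊤ := hφ.neg.lintegral_lt_top.ne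
  rw [integral_eq_lintegral_pos_part_sub_lintegral_neg_part hφ, EReal.coe_sub,
    EReal.coe_ennreal_toReal h1, EReal.coe_ennreal_toReal h2]
  simp only [erealIntegral, ← EReal.coe_neg, epos_coe]

lemma tendsto_erealIntegral_of_monotone {α : Type*} [MeasurableSpace α] {Q : Measure α}
    {u : ℕ → α → ℝ} {h : α → EReal} (hu : ∀ n, Integrable (u n) Q)
    (hmono : ∀ x, Monotone fun n => u n x)
    (hlim : ∀ᵐ x ∂Q, (∃ r : ℝ, h x = r ∧ Tendsto (fun n => u n x) atTop (𝓝 r)) ∨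
      (h x = ⊤ ∧ Tendsto (fun n => u n x) atTop atTop)) :
    Tendsto (fun n => erealIntegral Q fun x => (u n x : EReal)) atTop (𝓝 (erealIntegral Q h)) := by
  have hpos : Tendsto (fun n => ∫⁻ x, ENNReal.ofReal (u n x) ∂Q) atTop
      (𝓝 (∫⁻ x, epos (h x) ∂Q)) := by
    refine lintegral_tendsto_of_tendsto_of_monotone (fun n => (hu n).aemeasurable.ennreal_ofReal)
      (.of_forall fun x m n hmn => ENNReal.ofReal_le_ofReal (hmono x hmn)) ?_
    filter_upwards [hlim] with x hx
    rcases hx with ⟨r, hr, ht⟩ | ⟨hr, ht⟩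
    · rw [hr, epos_coe]
      exact ENNReal.tendsto_ofReal ht
    · simpa [hr, epos] using ENNReal.tendsto_ofReal_nhds_top.2 ht
  have hneg : Tendsto (fun n => ∫⁻ x, ENNReal.ofReal (-u n x) ∂Q) atTop
      (𝓝 (∫⁻ x, epos (-h x) ∂Q)) := by
    refine lintegral_tendsto_of_tendsto_of_antitone
      (fun n => (hu n).neg.aemeasurable.ennreal_ofReal)
      (.of_forall fun x m n hmn => ENNReal.ofReal_le_ofReal (neg_le_neg (hmono x hmn)))
      (hu 0).neg.lintegral_lt_top.ne ?_
    filter_upwards [hlim] with x hx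
    rcases hx with ⟨r, hr, ht⟩ | ⟨hr, ht⟩
    · rw [hr, ← EReal.coe_neg, epos_coe]
      exact ENNReal.tendsto_ofReal ht.neg
    · refine tendsto_const_nhds.congr' ?_
      filter_upwards [ht.eventually_ge_atTop 0] with n hn
      simp [hr, epos, ENNReal.ofReal_of_nonpos (neg_nonpos.2 hn)]
  have hfin : ∫⁻ x, epos (-h x) ∂Q ≠ ⊤ :=
    ((le_of_tendsto' hneg fun n => lintegral_mono fun x => ENNReal.ofReal_le_ofReal <|
      neg_le_neg (hmono x (Nat.zero_le n))).trans_lt (hu 0).neg.lintegral_lt_top).ne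
  simp only [erealIntegral, ← EReal.coe_neg, epos_coe]
  have hc : ContinuousAt (fun p : EReal × EReal => p.1 + p.2)
      (((∫⁻ x, epos (h x) ∂Q : ℝ≥0∞) : EReal), -((∫⁻ x, epos (-h x) ∂Q : ℝ≥0∞) : EReal)) :=
    EReal.continuousAt_add (.inr (by simpa using hfin)) (.inl (EReal.coe_ennreal_ne_bot _))
  exact hc.tendsto.comp (((continuous_coe_ennreal_ereal.tendsto _).comp hpos).prodMk_nhds
    ((continuous_neg.tendsto _).comp ((continuous_coe_ennreal_ereal.tendsto _).comp hneg)))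

end ERealIntegral

lemma LipschitzWith.integrable_of_integrable_norm {E : Type*} [NormedAddCommGroup E]
    [MeasurableSpace E] [BorelSpace E] {Q : Measure E} [IsFiniteMeasure Q] {φ : E → ℝ} {K : NNReal}
    (hφ : LipschitzWith K φ) (hQ : Integrable (fun x => ‖x‖) Q) : Integrable φ Q := by
  refine ((hQ.const_mul (K : ℝ)).add (integrable_const |φ 0|)).mono'
    hφ.continuous.measurable.aestronglyMeasurable (.of_forall fun x => ?_)
  have h1 := hφ.dist_le_mul x 0
  rw [dist_zero_right, Real.dist_eq] at h1
  have h2 := abs_sub_abs_le_abs_sub (φ x) (φ 0)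
  simp only [Real.norm_eq_abs, Pi.add_apply]
  linarith

lemma IsLCProj.integrable_norm {E : Type*} [NormedAddCommGroup E] [NormedSpace ℝ E]
    [MeasureSpace E] [BorelSpace E] {P : Measure E} [IsProbabilityMeasure P] {fs : E → ℝ}
    (hfs : IsLCProj P fs)
    (hP : Integrable (fun x => ‖x‖) P) :
    Integrable (fun x => ‖x‖) (densityMeasure fs) :=
  hfs.integrable_of_nonneg convexOn_univ_norm continuous_norm norm_nonneg hP

section ConvexOrder

variable {E : Type*} [NormedAddCommGroup E] [InnerProductSpace ℝ E] [FiniteDimensional ℝ E]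
  [MeasureSpace E] [BorelSpace E] {P : Measure E} [IsProbabilityMeasure P] {fs : E → ℝ}

theorem IsLCProj.erealIntegral_le [(volume : Measure E).IsAddHaarMeasure] (hfs : IsLCProj P fs)
    (hP : Integrable (fun x => ‖x‖) P) {h : E → EReal} (hbot : ∀ x, h x ≠ ⊥)
    (hconv : ∀ x y : E, ∀ t : ℝ, t ∈ Set.Icc (0 : ℝ) 1 →
      h ((1 - t) • x + t • y) ≤ ((1 - t : ℝ) : EReal) * h x + (t : EReal) * h y) :
    erealIntegral (densityMeasure fs) h ≤ erealIntegral P h := by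
  have := hfs.1.1.isProbabilityMeasure
  have hPs := hfs.integrable_norm hP
  set D : Set E := {x | h x ≠ ⊤}
  set k : E → ℝ := fun x => (h x).toReal
  have hkD : ∀ x ∈ D, h x = k x := fun x hx => (EReal.coe_toReal hx (hbot x)).symm
  rcases D.eq_empty_or_nonempty with hD | hD
  · have htop : ∀ x, h x = ⊤ := fun x => by
      by_contra hx
      exact (hD ▸ hx : x ∈ (∅ : Set E))
    simp [erealIntegral, htop, epos]
  have hcv : ∀ x ∈ D, ∀ y ∈ D, ∀ a b : ℝ, 0 ≤ a → 0 ≤ b → a + b = 1 →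
      h (a • x + b • y) ≤ ((a * k x + b * k y : ℝ) : EReal) := by
    intro x hx y hy a b ha hb hab
    have := hconv x y b ⟨hb, by linarith⟩
    rwa [hkD x hx, hkD y hy, ← eq_sub_of_add_eq hab, ← EReal.coe_mul, ← EReal.coe_mul,
      ← EReal.coe_add] at this
  have hDc : Convex ℝ D := fun x hx y hy a b ha hb hab =>
    ((hcv x hx y hy a b ha hb hab).trans_lt (EReal.coe_lt_top _)).ne
  have hk : ConvexOn ℝ D k := ⟨hDc, fun x hx y hy a b ha hb hab => by
    have h1 := hcv x hx y hy a b ha hb hab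
    rw [hkD _ (hDc hx hy ha hb hab)] at h1
    exact_mod_cast h1⟩
  obtain ⟨A, B, hB0, hB⟩ := hk.exists_linear_lower_bound hD
  let u : ℕ → E → ℝ := fun n => lipschitzReg D k (B + n)
  have hL : ∀ n : ℕ, B ≤ B + n := fun n => by simp
  have hlip := fun n => lipschitzWith_lipschitzReg hD hB hB0 (hL n)
  have hLtop : Tendsto (fun n : ℕ => B + (n : ℝ)) atTop atTop :=
    tendsto_atTop_add_const_left _ _ tendsto_natCast_atTop_atTop
  have hu : ∀ n, erealIntegral (densityMeasure fs) (fun x => (u n x : EReal)) ≤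
      erealIntegral P h := by
    intro n
    have hi := (hlip n).integrable_of_integrable_norm hP
    have his := (hlip n).integrable_of_integrable_norm hPs
    calc erealIntegral (densityMeasure fs) (fun x => (u n x : EReal))
        ≤ erealIntegral P (fun x => (u n x : EReal)) := by
          rw [erealIntegral_coe hi, erealIntegral_coe his, EReal.coe_le_coe_iff]
          exact hfs.integral_le (convexOn_lipschitzReg hk hD hB hB0 (hL n)) (hlip n).continuous
            hi his
      _ ≤ erealIntegral P h := erealIntegral_mono P fun x => by
          by_cases hx : x ∈ D
          · rw [hkD x hx, EReal.coe_le_coe_iff]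
            exact lipschitzReg_le_self hB hB0 (hL n) hx
          · rw [not_not.1 hx]
            exact le_top
  refine le_of_tendsto' (tendsto_erealIntegral_of_monotone
    (fun n => (hlip n).integrable_of_integrable_norm hPs)
    (fun x m n hmn => lipschitzReg_mono hD hB hB0 (hL m) (by gcongr) x) ?_) hu
  have hfr : ∀ᵐ x ∂(densityMeasure fs), x ∉ frontier D :=
    (withDensity_absolutelyContinuous volume _).ae_le
      (measure_eq_zero_iff_ae_notMem.1 (hDc.addHaar_frontier volume))
  filter_upwards [hfr] with x hx
  by_cases hxc : x ∈ closure D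
  · have hxi : x ∈ interior D := by
      by_contra hxi
      exact hx ⟨hxc, hxi⟩
    refine .inl ⟨k x, hkD x (interior_subset hxi), tendsto_const_nhds.congr' ?_⟩
    filter_upwards [hLtop.eventually (eventually_lipschitzReg_eq hk hB hB0 hxi)] with n hn
    exact hn.symm
  · exact .inr ⟨not_not.1 fun hxD => hxc (subset_closure hxD),
      (tendsto_lipschitzReg_atTop hD hB hB0 hxc).comp hLtop⟩

theorem IsLCProj.integral_id_eq (hfs : IsLCProj P fs) (hP : Integrable (fun x => ‖x‖) P) :
    ∫ x, x ∂(densityMeasure fs) = ∫ x, x ∂P := by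
  have := hfs.1.1.isProbabilityMeasure
  have hid : Integrable (fun x : E => x) P := (integrable_norm_iff aestronglyMeasurable_id).1 hP
  have hids : Integrable (fun x : E => x) (densityMeasure fs) :=
    (integrable_norm_iff aestronglyMeasurable_id).1 (hfs.integrable_norm hP)
  have hle : ∀ v : E, ∫ x, inner ℝ v x ∂(densityMeasure fs) ≤ ∫ x, inner ℝ v x ∂P := fun v =>
    hfs.integral_le ((innerₛₗ ℝ v).convexOn convex_univ) (by fun_prop) (hid.const_inner v)
      (hids.const_inner v)
  refine ext_inner_left ℝ fun v => ?_
  rw [← integral_inner hid, ← integral_inner hids]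
  refine (hle v).antisymm ?_
  simpa [inner_neg_left, integral_neg] using hle (-v)

end ConvexOrder

section SecondMoment

variable {d : ℕ} {Q : Measure (Rd d)}

lemma integrable_norm_sub_sq {E : Type*} [NormedAddCommGroup E] [MeasurableSpace E]
    [BorelSpace E] [SecondCountableTopology E] {Q : Measure E} [IsFiniteMeasure Q]
    (hQ : Integrable (fun x => ‖x‖ ^ 2) Q) (m : E) : Integrable (fun x => ‖x - m‖ ^ 2) Q := by
  have h : MemLp (fun x : E => x) 2 Q :=
    (memLp_two_iff_integrable_sq_norm aestronglyMeasurable_id).2 hQ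
  exact (memLp_two_iff_integrable_sq_norm (by fun_prop)).1 (h.sub (memLp_const m))

lemma integrable_coord_mul_coord [IsFiniteMeasure Q] (hQ : Integrable (fun x => ‖x‖ ^ 2) Q)
    (m : Rd d) (i j : Fin d) : Integrable (fun x : Rd d => (x i - m i) * (x j - m j)) Q := by
  refine (integrable_norm_sub_sq hQ m).mono'
    (Continuous.measurable (by fun_prop)).aestronglyMeasurable (.of_forall fun x => ?_)
  rw [norm_mul, sq]
  exact mul_le_mul (PiLp.norm_apply_le (x - m) i) (PiLp.norm_apply_le (x - m) j) (norm_nonneg _)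
    (norm_nonneg _)

lemma sq_sum_mul_coord (m : Rd d) (v : Fin d → ℝ) (x : Rd d) :
    (∑ i, v i * (x i - m i)) ^ 2 = ∑ i, ∑ j, v i * v j * ((x i - m i) * (x j - m j)) := by
  rw [sq, Finset.sum_mul_sum]
  exact Finset.sum_congr rfl fun i _ => Finset.sum_congr rfl fun j _ => by ring

lemma integrable_sq_sum_mul_coord [IsFiniteMeasure Q] (hQ : Integrable (fun x => ‖x‖ ^ 2) Q)
    (m : Rd d) (v : Fin d → ℝ) :
    Integrable (fun x : Rd d => (∑ i, v i * (x i - m i)) ^ 2) Q := by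
  simp_rw [sq_sum_mul_coord]
  exact integrable_finsetSum _ fun i _ => integrable_finsetSum _ fun j _ =>
    (integrable_coord_mul_coord hQ m i j).const_mul _

lemma integral_sq_sum_mul_coord [IsFiniteMeasure Q] (hQ : Integrable (fun x => ‖x‖ ^ 2) Q)
    (m : Rd d) (v : Fin d → ℝ) :
    ∫ x : Rd d, (∑ i, v i * (x i - m i)) ^ 2 ∂Q =
      ∑ i, ∑ j, v i * v j * ∫ x : Rd d, (x i - m i) * (x j - m j) ∂Q := by
  have hint := fun i j => (integrable_coord_mul_coord hQ m i j).const_mul (v i * v j)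
  simp_rw [sq_sum_mul_coord]
  rw [integral_finsetSum _ fun i _ => integrable_finsetSum _ fun j _ => hint i j]
  refine Finset.sum_congr rfl fun i _ => ?_
  rw [integral_finsetSum _ fun j _ => hint i j]
  exact Finset.sum_congr rfl fun j _ => integral_const_mul _ _

lemma convexOn_sq_sum_mul_coord (m : Rd d) (v : Fin d → ℝ) :
    ConvexOn ℝ univ fun x : Rd d => (∑ i, v i * (x i - m i)) ^ 2 := by
  refine ⟨convex_univ, fun x _ y _ a b ha hb hab => ?_⟩
  have h : ∑ i, v i * ((a • x + b • y) i - m i) =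
      a • ∑ i, v i * (x i - m i) + b • ∑ i, v i * (y i - m i) := by
    simp only [smul_eq_mul, Finset.mul_sum, ← Finset.sum_add_distrib]
    refine Finset.sum_congr rfl fun i _ => ?_
    simp only [PiLp.add_apply, PiLp.smul_apply, smul_eq_mul]
    linear_combination (-v i * m i) * hab.symm
  simp only [h]
  exact (even_two.convexOn_pow (𝕜 := ℝ)).2 (mem_univ _) (mem_univ _) ha hb hab

theorem IsLCProj.posSemidef_sub {P : Measure (Rd d)} [IsProbabilityMeasure P] {fs : Rd d → ℝ}
    (hfs : IsLCProj P fs) (hP : Integrable (fun x => ‖x‖ ^ 2) P) (m : Rd d) :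
    Matrix.PosSemidef (Matrix.of fun i j : Fin d =>
      (∫ x : Rd d, (x i - m i) * (x j - m j) ∂P) -
        ∫ x : Rd d, (x i - m i) * (x j - m j) ∂(densityMeasure fs)) := by
  have := hfs.1.1.isProbabilityMeasure
  have hPs : Integrable (fun x : Rd d => ‖x‖ ^ 2) (densityMeasure fs) :=
    hfs.integrable_of_nonneg (convexOn_univ_norm.pow (fun x _ => norm_nonneg x) 2) (by fun_prop)
      (fun x => sq_nonneg _) hP
  refine .of_dotProduct_mulVec_nonneg ?_ fun v => ?_
  · ext i j
    simp only [Matrix.conjTranspose_apply, Matrix.of_apply, star_trivial, mul_comm]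
  have hle := hfs.integral_le_of_nonneg (convexOn_sq_sum_mul_coord m v) (by fun_prop)
    (fun x => sq_nonneg _) (integrable_sq_sum_mul_coord hP m v)
  rw [integral_sq_sum_mul_coord hP, integral_sq_sum_mul_coord hPs, ← sub_nonneg,
    ← Finset.sum_sub_distrib] at hle
  refine hle.trans_eq (Finset.sum_congr rfl fun i _ => ?_)
  rw [← Finset.sum_sub_distrib, Pi.star_apply, star_trivial, Matrix.mulVec, dotProduct,
    Finset.mul_sum]
  exact Finset.sum_congr rfl fun j _ => by simp only [Matrix.of_apply]; ring

end SecondMoment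

/-- The log-concave projection measure `P*` is dominated by `P` in the convex order; in
particular it preserves the mean and shrinks the second moment. -/
theorem statement9 (d : ℕ) (P : Measure (Rd d)) (hP : MemP P)
    (fs : Rd d → ℝ) (hfs : IsLCProj P fs) :
    (∀ h : Rd d → EReal, (∀ x, h x ≠ ⊥) →
        (∀ x y : Rd d, ∀ t : ℝ, t ∈ Set.Icc (0:ℝ) 1 →
          h ((1 - t) • x + t • y) ≤
            (((1 - t : ℝ)) : EReal) * h x + ((t : ℝ) : EReal) * h y) →
        erealIntegral (volume.withDensity fun x => ENNReal.ofReal (fs x)) h ≤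
          erealIntegral P h) ∧
    (∫ x, x ∂(volume.withDensity fun x => ENNReal.ofReal (fs x)) : Rd d) = (∫ x, x ∂P) ∧
    (Integrable (fun x : Rd d => ‖x‖ ^ 2) P →
      Matrix.PosSemidef (Matrix.of fun i j : Fin d =>
        (∫ x : Rd d, (x i - (∫ y : Rd d, y ∂P) i) * (x j - (∫ y : Rd d, y ∂P) j) ∂P) -
        (∫ x : Rd d, (x i - (∫ y : Rd d, y ∂P) i) * (x j - (∫ y : Rd d, y ∂P) j)
          ∂(volume.withDensity fun x => ENNReal.ofReal (fs x))))) := by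
  have := hP.1
  exact ⟨fun h hbot hconv => hfs.erealIntegral_le hP.2.1 hbot hconv,
    hfs.integral_id_eq hP.2.1, fun h2 => hfs.posSemidef_sub h2 _⟩
end
end
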